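/- For every positive integer w and every ε > 0 there exists S such that: for every finite poset P of width at most w and every x ∈ P with σ(x) ≥ S, one has δ_x > 1/2 − ε. In particular, for every finite poset P with w(P) ≤ w and σ(P) ≥ S one has δ(P) > 1/2 − ε. -/

import Mathlib

open Finset

section Defs
variable (α : Type*) [Fintype α] [PartialOrder α]

/-- Linear extensions of a finite poset `α` with `n` elements: order-preserving
bijections to `Fin n` (representing the target `{1,…,n}`). -/
def LinExt : Type _ :=
  {f : α ≃ Fin (Fintype.card α) // ∀ x y : α, x < y → f x < f y}

instance : Finite (LinExt α) := by unfold LinExt; infer_instance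

noncomputable instance : Fintype (LinExt α) := Fintype.ofFinite _

end Defs

section Defs2
variable {α : Type*} [Fintype α] [PartialOrder α]

/-- the uniform probability `ℙ(E)` of an event `E` on linear extensions -/
noncomputable def Pr (E : LinExt α → Prop) : ℝ :=
  (Nat.card {f : LinExt α // E f} : ℝ) / (Nat.card (LinExt α) : ℝ)

/-- the value `f(x) ∈ {1,…,n}` of a linear extension at `x` -/
def val (f : LinExt α) (x : α) : ℕ := (f.1 x : ℕ) + 1

/-- `ℙ(x ≺ y)`, the probability that `x` precedes `y` in a uniform linear extension -/
noncomputable def prLT (x y : α) : ℝ := Pr (fun f => val f x < val f y)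

/-- the expectation `𝔼 f(x)` for `f` uniform on `E(P)` -/
noncomputable def expec (x : α) : ℝ :=
  (∑ f : LinExt α, (val f x : ℝ)) / (Nat.card (LinExt α) : ℝ)

/-- the variance `Var(f(x))` for `f` uniform on `E(P)` -/
noncomputable def variance (x : α) : ℝ :=
  (∑ f : LinExt α, ((val f x : ℝ) - expec x) ^ 2) / (Nat.card (LinExt α) : ℝ)

/-- the standard deviation `σ(x)` of `f(x)` -/
noncomputable def sigma (x : α) : ℝ := Real.sqrt (variance x)

/-- `π(x)`: the number of elements of the poset incomparable to `x` -/
noncomputable def piVal (x : α) : ℕ := Nat.card {y : α // ¬ x ≤ y ∧ ¬ y ≤ x}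

/-- `q(x) = max_{k ∈ {1,…,n}} ℙ(f(x) = k)` -/
noncomputable def qVal (x : α) : ℝ :=
  ⨆ k : Fin (Fintype.card α), Pr (fun f => val f x = (k : ℕ) + 1)

end Defs2

section LinearOrderings
open scoped Classical

variable {β : Type*}

/-- Put `m` at the front (`σ = true`) or at the back (`σ = false`) of a list. -/
def addEnd (σ : Bool) (m : β) (l : List β) : List β := if σ then m :: l else l ++ [m]

lemma addEnd_inj {σ : Bool} {m m' : β} {l l' : List β} :
    addEnd σ m l = addEnd σ m' l' ↔ m = m' ∧ l = l' := by
  cases σ <;> simp [addEnd, and_comm]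

lemma exists_eq_addEnd (σ : Bool) {l : List β} (hl : l ≠ []) : ∃ m l', l = addEnd σ m l' := by
  cases σ
  · exact ⟨l.getLast hl, l.dropLast, by simp [addEnd, List.dropLast_append_getLast]⟩
  · exact ⟨l.head hl, l.tail, by simp [addEnd]⟩

variable [PartialOrder β]

/-- `before σ y x` says that `y` lies strictly below `x` when `σ` is true, and strictly above
`x` when `σ` is false. -/
def before (σ : Bool) (y x : β) : Prop := if σ then y < x else x < y

/-- The minimal (`σ = true`) or maximal (`σ = false`) elements of `X`. -/
noncomputable def ends (σ : Bool) (X : Finset β) : Finset β :=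
  X.filter fun x => ∀ y ∈ X, ¬ before σ y x

/-- The linear extensions of the subposet `X`, as lists. -/
noncomputable def linLists (X : Finset β) : Finset (List β) :=
  X.val.lists.toFinset.filter (List.Pairwise fun a b => ¬ b < a)

lemma before_trans {σ : Bool} {a b c : β} (h : before σ a b) (h' : before σ b c) :
    before σ a c := by
  cases σ
  · exact lt_trans (show c < b from h') (show b < a from h)
  · exact lt_trans (show a < b from h) (show b < c from h')

lemma before_irrefl (σ : Bool) (a : β) : ¬ before σ a a := by
  cases σ <;> exact lt_irrefl a

lemma before_not {σ : Bool} {a b : β} : before (!σ) a b ↔ before σ b a := by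
  cases σ <;> simp [before]

lemma mem_ends {σ : Bool} {X : Finset β} {x : β} :
    x ∈ ends σ X ↔ x ∈ X ∧ ∀ y ∈ X, ¬ before σ y x := by
  simp [ends]

lemma exists_mem_ends (σ : Bool) (X : Finset β) (hX : X.Nonempty) : (ends σ X).Nonempty := by
  cases σ
  · obtain ⟨m, hm⟩ := X.exists_maximal hX
    exact ⟨m, mem_ends.2 ⟨hm.1, fun y hy h => hm.not_gt hy h⟩⟩
  · obtain ⟨m, hm⟩ := X.exists_minimal hX
    exact ⟨m, mem_ends.2 ⟨hm.1, fun y hy h => hm.not_lt hy h⟩⟩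

lemma mem_linLists {X : Finset β} {l : List β} :
    l ∈ linLists X ↔ l.Nodup ∧ (∀ y, y ∈ l ↔ y ∈ X) ∧ l.Pairwise fun a b => ¬ b < a := by
  unfold linLists
  rw [mem_filter, Multiset.mem_toFinset, Multiset.mem_lists_iff, ← and_assoc]
  refine and_congr_left fun _ => ⟨fun h => ⟨?_, fun y => ?_⟩, fun ⟨h, h'⟩ => ?_⟩
  · exact Multiset.coe_nodup.1 (h ▸ X.nodup :)
  · exact (h ▸ Iff.rfl : y ∈ (l : Multiset β) ↔ y ∈ X.val)
  · exact (Multiset.Nodup.ext X.nodup (Multiset.coe_nodup.2 h)).2 fun y => by simp [h']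

lemma length_of_mem_linLists {X : Finset β} {l : List β} (h : l ∈ linLists X) :
    l.length = #X := by
  have := (mem_filter.1 h).1
  rw [Multiset.mem_toFinset, Multiset.mem_lists_iff] at this
  exact (congrArg Multiset.card this).symm

lemma cons_mem_linLists {X : Finset β} {m : β} {l : List β} :
    m :: l ∈ linLists X ↔ m ∈ ends true X ∧ l ∈ linLists (X.erase m) := by
  simp only [mem_linLists, List.nodup_cons, List.mem_cons, List.pairwise_cons, mem_ends,
    mem_erase, before, if_true]
  constructor
  · rintro ⟨⟨h1, h2⟩, h3, h4, h5⟩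
    refine ⟨⟨(h3 m).1 (Or.inl rfl), fun y hy => ?_⟩, h2, fun y => ⟨fun h => ⟨?_, ?_⟩, ?_⟩, h5⟩
    · rcases (h3 y).2 hy with rfl | h
      · exact lt_irrefl _
      · exact h4 y h
    · rintro rfl; exact h1 h
    · exact (h3 y).1 (Or.inr h)
    · rintro ⟨h, h'⟩
      exact ((h3 y).2 h').resolve_left h
  · rintro ⟨⟨h1, h2⟩, h3, h4, h5⟩
    refine ⟨⟨fun h => ((h4 m).1 h).1 rfl, h3⟩, fun y => ⟨?_, fun h => ?_⟩,
      fun y hy => h2 y ((h4 y).1 hy).2, h5⟩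
    · rintro (rfl | h)
      · exact h1
      · exact ((h4 y).1 h).2
    · by_cases hy : y = m
      · exact Or.inl hy
      · exact Or.inr ((h4 y).2 ⟨hy, h⟩)

lemma concat_mem_linLists {X : Finset β} {m : β} {l : List β} :
    l ++ [m] ∈ linLists X ↔ m ∈ ends false X ∧ l ∈ linLists (X.erase m) := by
  simp only [mem_linLists, List.nodup_append, List.mem_append, List.pairwise_append, mem_ends,
    mem_erase, before, List.mem_singleton, List.nodup_singleton, List.pairwise_singleton]
  constructor
  · rintro ⟨⟨h2, -, h1⟩, h3, h5, -, h4⟩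
    refine ⟨⟨(h3 m).1 (Or.inr rfl), fun y hy => ?_⟩, h2, fun y => ⟨fun h => ⟨?_, ?_⟩, ?_⟩, h5⟩
    · rcases (h3 y).2 hy with h | rfl
      · exact h4 y h m rfl
      · exact lt_irrefl _
    · exact h1 y h m rfl
    · exact (h3 y).1 (Or.inl h)
    · rintro ⟨h, h'⟩
      exact ((h3 y).2 h').resolve_right h
  · rintro ⟨⟨h1, h2⟩, h3, h4, h5⟩
    refine ⟨⟨h3, trivial, ?_⟩, fun y => ⟨?_, fun h => ?_⟩, h5, trivial, ?_⟩
    · rintro a ha b rfl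
      exact ((h4 a).1 ha).1
    · rintro (h | rfl)
      · exact ((h4 y).1 h).2
      · exact h1
    · by_cases hy : y = m
      · exact Or.inr hy
      · exact Or.inl ((h4 y).2 ⟨hy, h⟩)
    · rintro a ha b rfl
      exact h2 a ((h4 a).1 ha).2

lemma addEnd_mem_linLists {σ : Bool} {X : Finset β} {m : β} {l : List β} :
    addEnd σ m l ∈ linLists X ↔ m ∈ ends σ X ∧ l ∈ linLists (X.erase m) := by
  cases σ
  · exact concat_mem_linLists
  · exact cons_mem_linLists

/-- Counting linear extensions satisfying `p` by their first or last element. -/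
lemma card_filter_linLists (σ : Bool) (X : Finset β) (p : List β → Prop)
    [DecidablePred p] (hp : ¬ p []) :
    #((linLists X).filter p) =
      ∑ m ∈ ends σ X, #((linLists (X.erase m)).filter fun l => p (addEnd σ m l)) := by
  rw [← card_sigma]
  symm
  refine card_bij (fun a _ => addEnd σ a.1 a.2) ?_ ?_ ?_
  · rintro ⟨m, l⟩ h
    simp only [mem_sigma, mem_filter] at h ⊢
    exact ⟨addEnd_mem_linLists.2 ⟨h.1, h.2.1⟩, h.2.2⟩
  · rintro ⟨m, l⟩ _ ⟨m', l'⟩ _ h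
    obtain ⟨rfl, rfl⟩ := addEnd_inj.1 h
    rfl
  · intro l hl
    rw [mem_filter] at hl
    obtain ⟨m, l', rfl⟩ := exists_eq_addEnd σ (l := l) (by rintro rfl; exact hp hl.2)
    have := addEnd_mem_linLists.1 hl.1
    exact ⟨⟨m, l'⟩, by simpa using ⟨this.1, this.2, hl.2⟩, rfl⟩

lemma card_linLists (σ : Bool) (X : Finset β) (hX : X.Nonempty) :
    #(linLists X) = ∑ m ∈ ends σ X, #(linLists (X.erase m)) := by
  have h := card_filter_linLists σ X (fun l => l ≠ []) (by simp)
  rw [filter_true_of_mem, sum_congr rfl fun m _ => ?_] at h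
  · exact h
  · rw [filter_true_of_mem]
    intro l _
    cases σ <;> simp [addEnd]
  · rintro l hl rfl
    have := length_of_mem_linLists hl
    exact hX.ne_empty (card_eq_zero.1 this.symm)

lemma linLists_empty : linLists (∅ : Finset β) = {[]} := by
  ext l
  rw [mem_linLists, mem_singleton]
  constructor
  · rintro ⟨-, h, -⟩
    exact List.eq_nil_iff_forall_not_mem.2 fun a ha => by simpa using (h a).1 ha
  · rintro rfl; simp

lemma card_linLists_pos (X : Finset β) : 0 < #(linLists X) := by
  induction X using Finset.strongInduction with
  | H X ih =>
    rcases X.eq_empty_or_nonempty with rfl | hX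
    · simp [linLists_empty]
    · rw [card_linLists true X hX]
      obtain ⟨m, hm⟩ := exists_mem_ends true X hX
      exact sum_pos (fun m hm => ih _ (erase_ssubset (mem_ends.1 hm).1)) ⟨m, hm⟩

end LinearOrderings

section Hyperbolic
open Matrix

variable {ι : Type*} [Fintype ι]

/-- A bilinear form satisfies the reversed Cauchy–Schwarz inequality in positive directions. -/
def Hyperbolic (M : Matrix ι ι ℝ) : Prop :=
  ∀ v w : ι → ℝ, 0 < w ⬝ᵥ M *ᵥ w → (v ⬝ᵥ M *ᵥ v) * (w ⬝ᵥ M *ᵥ w) ≤ (v ⬝ᵥ M *ᵥ w) ^ 2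

lemma dotProduct_mulVec_comm' {M : Matrix ι ι ℝ} (hM : M.IsSymm) (v w : ι → ℝ) :
    v ⬝ᵥ M *ᵥ w = w ⬝ᵥ M *ᵥ v := by
  rw [dotProduct_mulVec, ← mulVec_transpose, hM.eq, dotProduct_comm]

lemma hyperbolic_of_nonpos_on_orthogonal {M : Matrix ι ι ℝ} (hM : M.IsSymm) (h : ι → ℝ)
    (hh : ∀ v, v ⬝ᵥ M *ᵥ h = 0 → v ⬝ᵥ M *ᵥ v ≤ 0) : Hyperbolic M := by
  intro v w hw
  have hwh : w ⬝ᵥ M *ᵥ h ≠ 0 := fun h0 => (hh w h0).not_gt hw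
  have key : ∀ t s : ℝ, s * (w ⬝ᵥ M *ᵥ h) + v ⬝ᵥ M *ᵥ h = 0 →
      s ^ 2 * (w ⬝ᵥ M *ᵥ w) + 2 * s * (v ⬝ᵥ M *ᵥ w) + v ⬝ᵥ M *ᵥ v ≤ 0 := by
    intro t s hs
    have h1 := hh (s • w + v) (by simpa [add_dotProduct, smul_dotProduct] using hs)
    simp only [add_dotProduct, smul_dotProduct, mulVec_add, mulVec_smul, dotProduct_add,
      dotProduct_smul, smul_eq_mul, dotProduct_mulVec_comm' hM w v] at h1
    linarith
  have h2 := key 0 (-(v ⬝ᵥ M *ᵥ h) / (w ⬝ᵥ M *ᵥ h)) (by field_simp; ring)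
  set s := -(v ⬝ᵥ M *ᵥ h) / (w ⬝ᵥ M *ᵥ h)
  nlinarith [sq_nonneg (s * (w ⬝ᵥ M *ᵥ w) + v ⬝ᵥ M *ᵥ w)]

lemma mulVec_eq_zero_of_row {M : Matrix ι ι ℝ} (hM0 : ∀ i j, 0 ≤ M i j) {h : ι → ℝ}
    (hpos : ∀ i, 0 < h i) {i : ι} (hi : (M *ᵥ h) i = 0) (j : ι) : M i j = 0 := by
  have h1 := (sum_eq_zero_iff_of_nonneg fun j _ => mul_nonneg (hM0 i j) (hpos j).le).1 hi j
    (mem_univ j)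
  exact (mul_eq_zero.1 h1).resolve_right (hpos j).ne'

/-- The Dirichlet form of a symmetric matrix relative to a positive vector. -/
lemma sum_dirichlet {M : Matrix ι ι ℝ} (hM : M.IsSymm) {h d : ι → ℝ} (hpos : ∀ i, 0 < h i)
    (hd : ∀ i, (M *ᵥ h) i = d i * h i) (v : ι → ℝ) :
    ∑ i, ∑ j, M i j * (h i * h j) * (v i / h i - v j / h j) ^ 2 =
      2 * (∑ i, d i * v i ^ 2 - v ⬝ᵥ M *ᵥ v) := by
  have e1 : ∑ i, d i * v i ^ 2 = ∑ i, ∑ j, M i j * (h j * (v i ^ 2 / h i)) := by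
    refine sum_congr rfl fun i _ => ?_
    rw [eq_div_of_mul_eq (hpos i).ne' (hd i).symm, mulVec, dotProduct, sum_div, sum_mul]
    exact sum_congr rfl fun j _ => by ring
  have e2 : ∑ i, d i * v i ^ 2 = ∑ i, ∑ j, M i j * (h i * (v j ^ 2 / h j)) := by
    rw [e1, sum_comm]
    exact sum_congr rfl fun j _ => sum_congr rfl fun i _ => by rw [hM.apply]
  have e3 : v ⬝ᵥ M *ᵥ v = ∑ i, ∑ j, M i j * (v i * v j) := by
    refine sum_congr rfl fun i _ => ?_
    rw [mulVec, dotProduct, mul_sum]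
    exact sum_congr rfl fun j _ => by ring
  have : 2 * (∑ i, d i * v i ^ 2 - v ⬝ᵥ M *ᵥ v) =
      ∑ i, d i * v i ^ 2 + ∑ i, d i * v i ^ 2
        - 2 * v ⬝ᵥ M *ᵥ v := by ring
  rw [this]
  nth_rewrite 1 [e1]
  rw [e2, e3, ← sum_add_distrib, mul_sum, ← sum_sub_distrib]
  refine sum_congr rfl fun i _ => ?_
  rw [← sum_add_distrib, mul_sum, ← sum_sub_distrib]
  refine sum_congr rfl fun j _ => ?_
  have := (hpos i).ne'
  have := (hpos j).ne'
  field_simp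
  ring

/-- A symmetric matrix with zero rows where `d` vanishes is diagonalised, relative to the weights
`d`, by vectors `b k`. -/
lemma exists_weighted_eigenvectors [DecidableEq ι] {M : Matrix ι ι ℝ} (hM : M.IsSymm) {d : ι → ℝ}
    (hd : ∀ i, 0 ≤ d i) (hrow : ∀ i, d i = 0 → ∀ j, M i j = 0) :
    ∃ (b : ι → ι → ℝ) (l : ι → ℝ), (∀ k i, (M *ᵥ b k) i = l k * (d i * b k i)) ∧
      (∀ k, ∑ i, d i * b k i ^ 2 = 0 → l k = 0) ∧
      ∀ v : ι → ℝ, v ⬝ᵥ M *ᵥ v = ∑ k, l k * (∑ i, d i * b k i * v i) ^ 2 := by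
  set A : Matrix ι ι ℝ := fun i j => M i j / (√(d i) * √(d j)) with hA
  have hAs : A.IsHermitian := by
    refine Matrix.IsHermitian.ext fun i j => ?_
    simp only [hA, star_trivial, hM.apply, mul_comm]
  have hMA : ∀ i j, M i j = √(d i) * A i j * √(d j) := by
    intro i j
    by_cases hi : d i = 0
    · simp [hrow i hi, hi]
    by_cases hj : d j = 0
    · rw [← hM.apply, hrow j hj, hj]; simp
    have := (Real.sqrt_pos.2 ((hd i).lt_of_ne' hi)).ne'
    have := (Real.sqrt_pos.2 ((hd j).lt_of_ne' hj)).ne'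
    simp only [hA]
    field_simp
  have hss : ∀ i, √(d i) * √(d i) = d i := fun i => Real.mul_self_sqrt (hd i)
  set u := hAs.eigenvectorBasis
  set l := hAs.eigenvalues
  have hu : ∀ k, A *ᵥ (u k).ofLp = l k • (u k).ofLp := hAs.mulVec_eigenvectorBasis
  have hsu : ∀ k i, √(d i) * (u k i / √(d i)) * √(d i) = √(d i) * u k i := by
    intro k i
    by_cases hi : d i = 0
    · simp [hi]
    have := (Real.sqrt_pos.2 ((hd i).lt_of_ne' hi)).ne'
    field_simp
  have hsA : ∀ k i, A i k * (√(d k) / √(d k)) = A i k := by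
    intro k i
    by_cases hk : d k = 0
    · simp [hA, hk]
    have := (Real.sqrt_pos.2 ((hd k).lt_of_ne' hk)).ne'
    field_simp
  refine ⟨fun k i => u k i / √(d i), l, fun k i => ?_, fun k hk => ?_, fun v => ?_⟩
  · have h1 : (M *ᵥ fun i => u k i / √(d i)) i = √(d i) * (A *ᵥ (u k).ofLp) i := by
      simp only [mulVec, dotProduct, mul_sum]
      refine sum_congr rfl fun j _ => ?_
      rw [hMA]
      linear_combination √(d i) * u k j * hsA j i
    rw [h1, hu, Pi.smul_apply, smul_eq_mul]
    have := hsu k i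
    linear_combination -(l k) * this + l k * (u k i / √(d i)) * hss i
  · have h0 : ∀ i, √(d i) * u k i = 0 := by
      intro i
      have h2 := (sum_eq_zero_iff_of_nonneg fun i _ => mul_nonneg (hd i) (sq_nonneg _)).1 hk i
        (mem_univ i)
      rw [← hsu k i]
      rcases mul_eq_zero.1 h2 with h3 | h3
      · simp [h3]
      · rw [pow_eq_zero_iff two_ne_zero] at h3
        simp only [h3, mul_zero, zero_mul]
    have h1 : A *ᵥ (u k).ofLp = 0 := by
      ext i
      refine sum_eq_zero fun j _ => ?_
      linear_combination A i j / √(d j) * h0 j - u k j * hsA j i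
    rw [hu] at h1
    rcases smul_eq_zero.1 h1 with h2 | h2
    · exact h2
    · exact absurd (by ext i; exact congrFun h2 i : u k = 0) (u.orthonormal.ne_zero k)
  · set y : EuclideanSpace ℝ ι := WithLp.toLp 2 fun i => √(d i) * v i with hy
    have h1 : v ⬝ᵥ M *ᵥ v = y.ofLp ⬝ᵥ A *ᵥ y.ofLp := by
      simp only [hy, mulVec, dotProduct, mul_sum]
      refine sum_congr rfl fun i _ => sum_congr rfl fun j _ => ?_
      rw [hMA]; ring
    have h2 : y.ofLp = ∑ k, inner ℝ (u k) y • (u k).ofLp := by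
      conv_lhs => rw [← u.sum_repr' y]
      simp
    have h3 : ∀ k, inner ℝ (u k) y = ∑ i, d i * (u k i / √(d i)) * v i := by
      intro k
      rw [PiLp.inner_apply]
      refine sum_congr rfl fun i _ => ?_
      simp only [hy, RCLike.inner_apply, conj_trivial]
      have := hsu k i
      linear_combination -(v i) * this + v i * (u k i / √(d i)) * hss i
    have h4 : A *ᵥ y.ofLp = ∑ k, (inner ℝ (u k) y * l k) • (u k).ofLp := by
      conv_lhs => rw [h2]
      simp only [mulVec_sum, mulVec_smul, hu, smul_smul]
    rw [h1, h4, dotProduct_sum]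
    refine sum_congr rfl fun k _ => ?_
    rw [dotProduct_smul, ← h3, smul_eq_mul]
    have : y.ofLp ⬝ᵥ (u k).ofLp = inner ℝ (u k) y := by
      rw [EuclideanSpace.inner_eq_star_dotProduct]; simp
    rw [this]; ring

/-- The local-to-global step of the combinatorial atlas method. -/
theorem hyperbolic_of_atlas [DecidableEq ι] {M : Matrix ι ι ℝ} (hM : M.IsSymm)
    (hM0 : ∀ i j, 0 ≤ M i j)
    {h : ι → ℝ} (hpos : ∀ i, 0 < h i) (q : ι → (ι → ℝ) → ℝ)
    (hq0 : ∀ i v, (M *ᵥ h) i = 0 → q i v ≤ 0)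
    (inh : ∀ i v, q i v * (M *ᵥ h) i ≤ (M *ᵥ v) i ^ 2)
    (pull : ∀ v, v ⬝ᵥ M *ᵥ v ≤ ∑ i, h i * q i v)
    (conn : ∀ f : ι → ℝ, (∀ i j, 0 < M i j → f i = f j) →
      ∀ i j, 0 < (M *ᵥ h) i → 0 < (M *ᵥ h) j → f i = f j) :
    Hyperbolic M := by
  obtain ⟨d, hdh⟩ : ∃ d : ι → ℝ, ∀ i, (M *ᵥ h) i = d i * h i :=
    ⟨fun i => (M *ᵥ h) i / h i, fun i => (div_mul_cancel₀ _ (hpos i).ne').symm⟩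
  have hd : ∀ i, 0 ≤ d i := fun i => by
    refine nonneg_of_mul_nonneg_left ?_ (hpos i)
    rw [← hdh]
    exact sum_nonneg fun j _ => mul_nonneg (hM0 i j) (hpos j).le
  have hd0 : ∀ i, d i = 0 → (M *ᵥ h) i = 0 := fun i hi => by rw [hdh, hi, zero_mul]
  obtain ⟨b, l, hb, hl, hform⟩ := exists_weighted_eigenvectors hM hd
    fun i hi j => mulVec_eq_zero_of_row hM0 hpos (hd0 i hi) j
  have hbM : ∀ k, b k ⬝ᵥ M *ᵥ b k = l k * ∑ i, d i * b k i ^ 2 := by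
    intro k
    rw [mul_sum]
    exact sum_congr rfl fun i _ => by rw [hb]; ring
  refine hyperbolic_of_nonpos_on_orthogonal hM h fun v hv => ?_
  rw [hform]
  refine sum_nonpos fun k _ => ?_
  by_cases hk0 : l k ≤ 0
  · exact mul_nonpos_of_nonpos_of_nonneg hk0 (sq_nonneg _)
  push Not at hk0
  have hS : 0 < ∑ i, d i * b k i ^ 2 :=
    (sum_nonneg fun i _ => mul_nonneg (hd i) (sq_nonneg _)).lt_of_ne'
      fun h0 => hk0.ne' (hl k h0)
  have hk1 : 1 ≤ l k := by
    have h1 : ∀ i, h i * q i (b k) ≤ l k ^ 2 * (d i * b k i ^ 2) := by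
      intro i
      by_cases hi : d i = 0
      · rw [hi]
        have := mul_nonpos_of_nonneg_of_nonpos (hpos i).le (hq0 i (b k) (hd0 i hi))
        linarith
      · have hi : 0 < d i := (hd i).lt_of_ne' hi
        have := inh i (b k)
        rw [hb, hdh] at this
        exact le_of_mul_le_mul_left (by linarith) hi
    have h2 := (pull (b k)).trans (sum_le_sum fun i _ => h1 i)
    rw [hbM, ← mul_sum, pow_two, mul_assoc] at h2
    by_contra! hlt
    nlinarith [mul_pos hk0 hS]
  have hconst : ∀ i j, 0 < M i j → b k i / h i = b k j / h j := by
    have hdir := sum_dirichlet hM hpos hdh (b k)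
    rw [hbM] at hdir
    have hnn : ∀ i j, 0 ≤ M i j * (h i * h j) * (b k i / h i - b k j / h j) ^ 2 := fun i j =>
      mul_nonneg (mul_nonneg (hM0 i j) (mul_pos (hpos i) (hpos j)).le) (sq_nonneg _)
    have hz : ∑ i, ∑ j, M i j * (h i * h j) * (b k i / h i - b k j / h j) ^ 2 = 0 := by
      refine le_antisymm ?_ (sum_nonneg fun i _ => sum_nonneg fun j _ => hnn i j)
      rw [hdir]
      nlinarith
    intro i j hij
    have h1 := (sum_eq_zero_iff_of_nonneg fun i _ => sum_nonneg fun j _ => hnn i j).1 hz i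
      (mem_univ i)
    have h2 := (sum_eq_zero_iff_of_nonneg fun j _ => hnn i j).1 h1 j (mem_univ j)
    have h3 := (mul_eq_zero.1 h2).resolve_left
      (mul_pos hij (mul_pos (hpos i) (hpos j))).ne'
    exact sub_eq_zero.1 ((pow_eq_zero_iff two_ne_zero).1 h3)
  have hcc := conn (fun i => b k i / h i) hconst
  have hzero : ∑ i, d i * b k i * v i = 0 := by
    obtain ⟨i₀, -, hi₀⟩ := exists_lt_of_sum_lt
      (f := fun _ => (0 : ℝ)) (s := univ) (by simpa using hS)
    have hdi₀ : 0 < (M *ᵥ h) i₀ := by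
      rw [hdh]
      refine mul_pos ((hd i₀).lt_of_ne' fun h0 => ?_) (hpos i₀)
      simp [h0] at hi₀
    have : ∀ i, d i * b k i * v i = b k i₀ / h i₀ * (v i * (M *ᵥ h) i) := by
      intro i
      rcases (hd i).eq_or_lt with hi | hi
      · rw [hdh, ← hi]; ring
      · have h1 := hcc i i₀ (by rw [hdh]; exact mul_pos hi (hpos i)) hdi₀
        rw [← h1, hdh]
        have := (hpos i).ne'
        field_simp
    rw [sum_congr rfl fun i _ => this i, ← mul_sum]
    change _ * (v ⬝ᵥ M *ᵥ h) = 0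
    rw [hv, mul_zero]
  rw [hzero]; simp

end Hyperbolic

section Atlas
open scoped Classical
open Matrix

variable {β : Type*}

lemma sum_sides [Fintype β] (s : Bool → Finset β) (f : β × Bool → ℝ) :
    ∑ i, (if i.1 ∈ s i.2 then f i else 0) = ∑ σ, ∑ x ∈ s σ, f (x, σ) := by
  rw [Fintype.sum_prod_type, sum_comm]
  refine sum_congr rfl fun σ _ => ?_
  simp [sum_ite_mem]

variable [PartialOrder β]

/-- The minimal or maximal elements of `X` other than `z`. -/
noncomputable def freeEnds (z : β) (σ : Bool) (X : Finset β) : Finset β := (ends σ X).erase z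

lemma mem_freeEnds {z : β} {σ : Bool} {X : Finset β} {x : β} :
    x ∈ freeEnds z σ X ↔ x ≠ z ∧ x ∈ X ∧ ∀ y ∈ X, ¬ before σ y x := by
  rw [freeEnds, mem_erase, mem_ends]

lemma mem_freeEnds_erase {z : β} {σ : Bool} {X : Finset β} {x y : β} (hy : y ∈ freeEnds z σ X)
    (hxy : y ≠ x) : y ∈ freeEnds z σ (X.erase x) := by
  rw [mem_freeEnds] at hy ⊢
  exact ⟨hy.1, mem_erase.2 ⟨hxy, hy.2.1⟩, fun w hw => hy.2.2 w (mem_of_mem_erase hw)⟩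

lemma ne_of_mem_freeEnds_erase {z : β} {σ : Bool} {X : Finset β} {x y : β}
    (hy : y ∈ freeEnds z σ (X.erase x)) : y ≠ x :=
  (mem_erase.1 (mem_freeEnds.1 hy).2.1).1

lemma mem_freeEnds_erase_iff {z : β} {σ τ : Bool} (hστ : σ ≠ τ) {X : Finset β} {x y : β}
    (hx : x ∈ freeEnds z σ X) :
    y ∈ freeEnds z τ (X.erase x) ↔ y ∈ freeEnds z τ X ∧ y ≠ x := by
  refine ⟨fun h => ⟨?_, ne_of_mem_freeEnds_erase h⟩, fun h => mem_freeEnds_erase h.1 h.2⟩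
  rw [mem_freeEnds] at h hx ⊢
  refine ⟨h.1, mem_of_mem_erase h.2.1, fun w hw hwy => ?_⟩
  by_cases hwx : w = x
  · subst hwx
    obtain rfl : τ = !σ := by revert hστ; cases σ <;> cases τ <;> simp
    exact hx.2.2 y (mem_of_mem_erase h.2.1) (before_not.1 hwy)
  · exact h.2.2 w (mem_erase.2 ⟨hwx, hw⟩) hwy

lemma eq_of_mem_freeEnds_erase {z : β} {σ : Bool} {X : Finset β} {a b y : β}
    (hy : y ∉ freeEnds z σ X) (ha : y ∈ freeEnds z σ (X.erase a))
    (hb : y ∈ freeEnds z σ (X.erase b)) : a = b := by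
  rw [mem_freeEnds] at hy ha hb
  by_contra hab
  refine hy ⟨ha.1, mem_of_mem_erase ha.2.1, fun w hw hwy => ?_⟩
  by_cases hwa : w = a
  · exact hb.2.2 w (mem_erase.2 ⟨hwa ▸ hab, hw⟩) hwy
  · exact ha.2.2 w (mem_erase.2 ⟨hwa, hw⟩) hwy

/-- The number of linear extensions of `X` in which exactly `c true` elements precede `z` and
exactly `c false` elements follow it. -/
noncomputable def posCount (z : β) (X : Finset β) (c : Bool → ℕ) : ℝ :=
  #{l ∈ linLists X | l.length = c true + c false + 1 ∧ l[c true]? = some z}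

lemma posCount_nonneg (z : β) (X : Finset β) (c : Bool → ℕ) : 0 ≤ posCount z X c :=
  Nat.cast_nonneg _

lemma posCount_of_notMem {z : β} {X : Finset β} (h : z ∉ X) (c : Bool → ℕ) :
    posCount z X c = 0 := by
  rw [posCount, Nat.cast_eq_zero, card_eq_zero, filter_eq_empty_iff]
  rintro l hl ⟨-, hz⟩
  exact h (((mem_linLists.1 hl).2.1 z).1 (List.mem_of_getElem? hz))

lemma posCount_add_single (z : β) (X : Finset β) (c : Bool → ℕ) (σ : Bool) :
    posCount z X (c + Pi.single σ 1) = ∑ m ∈ freeEnds z σ X, posCount z (X.erase m) c := by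
  rw [freeEnds, sum_erase (f := fun m => posCount z (X.erase m) c) _
    (posCount_of_notMem (notMem_erase z X) c), posCount,
    card_filter_linLists σ _ _ (by simp), Nat.cast_sum]
  refine sum_congr rfl fun m _ => ?_
  rw [posCount]
  congr 2
  refine filter_congr fun l _ => ?_
  cases σ
  · simp only [addEnd, Pi.add_apply]
    simp only [Bool.false_eq_true, if_false, List.length_append, List.length_singleton, ne_eq,
      reduceCtorEq, not_false_eq_true, Pi.single_eq_of_ne, Pi.single_eq_same, add_zero]
    refine ⟨fun ⟨h, h'⟩ => ⟨by omega, ?_⟩, fun ⟨h, h'⟩ => ⟨by omega, ?_⟩⟩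
    · rwa [List.getElem?_append_left (by omega)] at h'
    · rwa [List.getElem?_append_left (by omega)]
  · simp only [addEnd, Pi.add_apply, if_true, List.length_cons, Pi.single_eq_same, ne_eq,
      reduceCtorEq, not_false_eq_true, Pi.single_eq_of_ne, add_zero, List.getElem?_cons_succ]
    refine and_congr_left fun _ => ?_
    omega

/-- The vector obtained from `w` after removing `x` from the side `σ` of `X`. -/
noncomputable def transfer (z : β) (X : Finset β) (i : β × Bool) (w : β × Bool → ℝ) :
    β × Bool → ℝ :=
  fun p => if p.1 ∈ freeEnds z p.2 X then w p else w i

/-- The linear form on end elements given by the counts of the remaining linear extensions. -/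
noncomputable def endForm (z : β) (X : Finset β) (c : Bool → ℕ) (w : β × Bool → ℝ) : ℝ :=
  ∑ τ, ∑ y ∈ freeEnds z τ X, posCount z (X.erase y) c * w (y, τ)

/-- The matrices of the combinatorial atlas of linear extensions. -/
noncomputable def atlasMat (z : β) (X : Finset β) (c : Bool → ℕ) :
    Matrix (β × Bool) (β × Bool) ℝ :=
  fun i j => (if i.1 ∈ freeEnds z i.2 X ∧ j.1 ∈ freeEnds z j.2 X ∧ i.1 ≠ j.1
      then posCount z ((X.erase i.1).erase j.1) c else 0) +
    if i = j ∧ i.1 ∈ freeEnds z i.2 X then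
      ∑ τ, ∑ y ∈ freeEnds z τ (X.erase i.1) with y ∉ freeEnds z τ X,
        posCount z ((X.erase i.1).erase y) c else 0

lemma atlasMat_isSymm (z : β) (X : Finset β) (c : Bool → ℕ) : (atlasMat z X c).IsSymm := by
  refine Matrix.IsSymm.ext fun i j => ?_
  by_cases hij : i = j
  · rw [hij]
  · have hji : j ≠ i := Ne.symm hij
    simp only [atlasMat, hij, hji, false_and, if_false, add_zero]
    rw [erase_right_comm]
    refine if_congr ?_ rfl rfl
    tauto

lemma atlasMat_nonneg (z : β) (X : Finset β) (c : Bool → ℕ) (i j : β × Bool) :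
    0 ≤ atlasMat z X c i j := by
  refine add_nonneg ?_ ?_ <;> split_ifs
  · exact posCount_nonneg _ _ _
  · exact le_rfl
  · exact sum_nonneg fun τ _ => sum_nonneg fun y _ => posCount_nonneg _ _ _
  · exact le_rfl

variable [Fintype β]

lemma atlasMat_mulVec (z : β) (X : Finset β) (c : Bool → ℕ) (w : β × Bool → ℝ) (i : β × Bool) :
    (atlasMat z X c *ᵥ w) i = if i.1 ∈ freeEnds z i.2 X then
      endForm z (X.erase i.1) c (transfer z X i w) else 0 := by
  split_ifs with hi
  · have h1 : (atlasMat z X c *ᵥ w) i = ∑ j : β × Bool, ((if j.1 ∈ (freeEnds z j.2 X).erase i.1 then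
        posCount z ((X.erase i.1).erase j.1) c * w j else 0)) +
        (∑ τ, ∑ y ∈ freeEnds z τ (X.erase i.1) with y ∉ freeEnds z τ X,
          posCount z ((X.erase i.1).erase y) c) * w i := by
      simp only [mulVec, dotProduct, atlasMat, hi, true_and, and_true, add_mul, sum_add_distrib,
        ite_mul, zero_mul, sum_ite_eq, mem_univ, if_true, mem_erase]
      congr 1
      refine sum_congr rfl fun j _ => if_congr ?_ rfl rfl
      rw [and_comm, ne_comm]
    rw [h1, sum_sides (fun τ => (freeEnds z τ X).erase i.1) fun j =>
      posCount z ((X.erase i.1).erase j.1) c * w j, endForm, sum_mul, ← sum_add_distrib]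
    refine sum_congr rfl fun τ _ => ?_
    rw [← sum_filter_add_sum_filter_not (freeEnds z τ (X.erase i.1)) (· ∈ freeEnds z τ X), sum_mul]
    congr 1
    · refine sum_congr ?_ fun y hy => ?_
      · ext y
        rw [mem_erase, mem_filter]
        exact ⟨fun h => ⟨mem_freeEnds_erase h.2 h.1, h.2⟩,
          fun h => ⟨ne_of_mem_freeEnds_erase h.1, h.2⟩⟩
      · simp [transfer, (mem_filter.1 hy).2]
    · refine sum_congr rfl fun y hy => ?_
      simp [transfer, (mem_filter.1 hy).2]
  · refine sum_eq_zero fun j _ => ?_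
    simp [atlasMat, hi]

lemma dotProduct_atlasMat_mulVec (z : β) (X : Finset β) (c : Bool → ℕ) (v w : β × Bool → ℝ) :
    v ⬝ᵥ atlasMat z X c *ᵥ w = ∑ σ, ∑ x ∈ freeEnds z σ X,
      v (x, σ) * endForm z (X.erase x) c (transfer z X (x, σ) w) := by
  rw [← sum_sides (fun σ => freeEnds z σ X) fun i =>
    v i * endForm z (X.erase i.1) c (transfer z X i w), dotProduct]
  refine sum_congr rfl fun i _ => ?_
  rw [atlasMat_mulVec, mul_ite, mul_zero]

end Atlas

section AtlasStep
open scoped Classical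
open Matrix

variable {β : Type*}

section TripleSums

variable [Fintype β]

/-- Triple sums are unchanged under exchanging the outer and the inner variable. -/
lemma sum_swap_outer_inner (f : β → β → β → ℝ) :
    ∑ u, ∑ x, ∑ y, f u x y = ∑ u, ∑ x, ∑ y, f y x u := by
  calc _ = ∑ x, ∑ u, ∑ y, f u x y := sum_comm
    _ = ∑ x, ∑ y, ∑ u, f u x y := sum_congr rfl fun x _ => sum_comm
    _ = _ := sum_comm

/-- Triple sums are unchanged under a cyclic shift of the variables. -/
lemma sum_cycle (f : β → β → β → ℝ) :
    ∑ u, ∑ x, ∑ y, f u x y = ∑ u, ∑ x, ∑ y, f x y u := by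
  calc _ = ∑ y, ∑ u, ∑ x, f u x y :=
        (sum_congr rfl fun u _ => sum_comm).trans sum_comm
    _ = _ := rfl

lemma sum_eq_zero_of_antisymm {f : β → β → β → ℝ} (h : ∀ u x y, f y x u = - f u x y) :
    ∑ u, ∑ x, ∑ y, f u x y = 0 := by
  have h1 := sum_swap_outer_inner f
  have h2 : ∑ u, ∑ x, ∑ y, f y x u = - ∑ u, ∑ x, ∑ y, f u x y := by
    simp only [← sum_neg_distrib]
    exact sum_congr rfl fun u _ => sum_congr rfl fun x _ => sum_congr rfl fun y _ => h u x y
  linarith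

lemma sum_dependent (s : Finset β) (t : β → Finset β) (r : β → β → Finset β)
    (f : β → β → β → ℝ) :
    ∑ u ∈ s, ∑ x ∈ t u, ∑ y ∈ r u x, f u x y =
      ∑ u, ∑ x, ∑ y, if u ∈ s ∧ x ∈ t u ∧ y ∈ r u x then f u x y else 0 := by
  have key : ∀ (s : Finset β) (g : β → ℝ), ∑ u ∈ s, g u = ∑ u, if u ∈ s then g u else 0 :=
    fun s g => by simp [sum_ite_mem]
  rw [key]
  refine sum_congr rfl fun u _ => ?_
  split_ifs with hu
  · rw [key]
    refine sum_congr rfl fun x _ => ?_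
    split_ifs with hx
    · rw [key]
      simp [hu, hx]
    · simp [hx]
  · simp [hu]

end TripleSums

variable [PartialOrder β]

lemma transfer_side {z : β} {X : Finset β} {i : β × Bool} (hi : i.1 ∈ freeEnds z i.2 X)
    (h : Bool → ℝ) {τ : Bool} {y : β} (hy : y ∈ freeEnds z τ (X.erase i.1)) :
    transfer z X i (fun p => h p.2) (y, τ) = h τ := by
  simp only [transfer]
  split_ifs with hyX
  · rfl
  · by_cases hτ : i.2 = τ
    · rw [hτ]
    · exact absurd ((mem_freeEnds_erase_iff hτ hi).1 hy).1 hyX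

/-- The combination of atlas matrices one level up. -/
noncomputable def stepMat (z : β) (X : Finset β) (c : Bool → ℕ) (h : Bool → ℝ) :
    Matrix (β × Bool) (β × Bool) ℝ :=
  ∑ ρ, h ρ • atlasMat z X (c + Pi.single ρ 1)

lemma stepMat_isSymm (z : β) (X : Finset β) (c : Bool → ℕ) (h : Bool → ℝ) :
    (stepMat z X c h).IsSymm := by
  rw [stepMat, Matrix.IsSymm, transpose_sum]
  exact sum_congr rfl fun ρ _ => by rw [transpose_smul, (atlasMat_isSymm z X _).eq]

lemma stepMat_nonneg (z : β) (X : Finset β) (c : Bool → ℕ) {h : Bool → ℝ} (hh : ∀ ρ, 0 < h ρ)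
    (i j : β × Bool) : 0 ≤ stepMat z X c h i j := by
  rw [stepMat, Matrix.sum_apply]
  exact sum_nonneg fun ρ _ => mul_nonneg (hh ρ).le (atlasMat_nonneg _ _ _ _ _)

/-- The counts of linear extensions of `X` with three elements removed. -/
noncomputable def posCount₃ (z : β) (X : Finset β) (c : Bool → ℕ) (u x y : β) : ℝ :=
  posCount z (((X.erase u).erase x).erase y) c

lemma posCount₃_swap (z : β) (X : Finset β) (c : Bool → ℕ) (u x y : β) :
    posCount₃ z X c y x u = posCount₃ z X c u x y := by
  rw [posCount₃, posCount₃, erase_right_comm (a := y), erase_right_comm (a := y),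
    erase_right_comm (a := x)]

lemma posCount₃_cycle (z : β) (X : Finset β) (c : Bool → ℕ) (u x y : β) :
    posCount₃ z X c x y u = posCount₃ z X c u x y := by
  rw [posCount₃, posCount₃, erase_right_comm (a := y), erase_right_comm (a := x)]

lemma posCount₃_swap' (z : β) (X : Finset β) (c : Bool → ℕ) (u x y : β) :
    posCount₃ z X c x u y = posCount₃ z X c u x y := by
  rw [posCount₃, posCount₃, erase_right_comm (a := x)]

lemma posCount₃_nonneg (z : β) (X : Finset β) (c : Bool → ℕ) (u x y : β) :
    0 ≤ posCount₃ z X c u x y := posCount_nonneg _ _ _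

variable [Fintype β]

lemma dotProduct_atlasMat_congr {z : β} {X : Finset β} (c : Bool → ℕ) {v v' : β × Bool → ℝ}
    (h : ∀ σ, ∀ x ∈ freeEnds z σ X, v (x, σ) = v' (x, σ)) (w : β × Bool → ℝ) :
    v ⬝ᵥ atlasMat z X c *ᵥ w = v' ⬝ᵥ atlasMat z X c *ᵥ w := by
  simp only [dotProduct_atlasMat_mulVec]
  exact sum_congr rfl fun σ _ => sum_congr rfl fun x hx => by rw [h σ x hx]

lemma sum_mul_endForm (z : β) (X : Finset β) (c : Bool → ℕ) (h : Bool → ℝ) (w : β × Bool → ℝ) :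
    ∑ ρ, h ρ * endForm z X (c + Pi.single ρ 1) w =
      w ⬝ᵥ atlasMat z X c *ᵥ fun p => h p.2 := by
  simp only [dotProduct_atlasMat_mulVec, endForm, mul_sum]
  rw [sum_comm]
  refine sum_congr rfl fun τ _ => ?_
  rw [sum_comm]
  refine sum_congr rfl fun y hy => sum_congr rfl fun ρ _ => ?_
  rw [posCount_add_single, sum_mul, mul_sum]
  refine sum_congr rfl fun u hu => ?_
  rw [transfer_side (i := (y, τ)) hy h hu]
  ring

lemma stepMat_mulVec (z : β) (X : Finset β) (c : Bool → ℕ) (h : Bool → ℝ) (v : β × Bool → ℝ)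
    (i : β × Bool) :
    (stepMat z X c h *ᵥ v) i = if i.1 ∈ freeEnds z i.2 X then
      transfer z X i v ⬝ᵥ atlasMat z (X.erase i.1) c *ᵥ fun p => h p.2 else 0 := by
  rw [stepMat, sum_mulVec, Finset.sum_apply]
  simp only [smul_mulVec, Pi.smul_apply, atlasMat_mulVec, smul_eq_mul, mul_ite, mul_zero]
  split_ifs
  · rw [sum_mul_endForm]
  · simp

lemma stepMat_mulVec_side (z : β) (X : Finset β) (c : Bool → ℕ) (h : Bool → ℝ) (i : β × Bool) :
    (stepMat z X c h *ᵥ fun p => h p.2) i = if i.1 ∈ freeEnds z i.2 X then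
      (fun p => h p.2) ⬝ᵥ atlasMat z (X.erase i.1) c *ᵥ fun p => h p.2 else 0 := by
  rw [stepMat_mulVec]
  split_ifs with hi
  · exact dotProduct_atlasMat_congr c (fun σ x hx => transfer_side hi h hx) _
  · rfl

end AtlasStep

section Pullback
open scoped Classical
open Matrix

variable {β : Type*} [PartialOrder β]

/-- The contribution of removing `u`, `x`, `y` in this order to the left side of the pullback
inequality. -/
noncomputable def pullTerm (z : β) (X : Finset β) (c : Bool → ℕ) (v : β × Bool → ℝ)
    (ρ σ τ : Bool) (u x y : β) : ℝ :=
  if u ∈ freeEnds z ρ X ∧ x ∈ freeEnds z σ (X.erase u) ∧ y ∈ freeEnds z τ ((X.erase u).erase x)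
  then posCount₃ z X c u x y * (transfer z X (u, ρ) v (x, σ) *
    transfer z (X.erase u) (x, σ) (transfer z X (u, ρ) v) (y, τ)) else 0

/-- The contribution of removing `x`, `y`, `u` in this order to the right side of the pullback
inequality. -/
noncomputable def baseTerm (z : β) (X : Finset β) (c : Bool → ℕ) (v : β × Bool → ℝ)
    (ρ σ τ : Bool) (x y u : β) : ℝ :=
  if x ∈ freeEnds z σ X ∧ y ∈ freeEnds z τ (X.erase x) ∧ u ∈ freeEnds z ρ ((X.erase x).erase y)
  then posCount₃ z X c x y u * (v (x, σ) * transfer z X (x, σ) v (y, τ)) else 0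

variable {z : β} {X : Finset β} {u x y : β} {ρ σ τ : Bool}

lemma pullTerm_eq_of_ne (c : Bool → ℕ) (v : β × Bool → ℝ) (h : ρ ≠ σ) :
    pullTerm z X c v ρ σ σ u x y = baseTerm z X c v ρ σ σ x y u := by
  have h' := h.symm
  have key : (u ∈ freeEnds z ρ X ∧ x ∈ freeEnds z σ (X.erase u) ∧
      y ∈ freeEnds z σ ((X.erase u).erase x)) ↔
      (x ∈ freeEnds z σ X ∧ y ∈ freeEnds z σ (X.erase x) ∧
        u ∈ freeEnds z ρ ((X.erase x).erase y)) := by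
    constructor
    · rintro ⟨hu, hx, hy⟩
      obtain ⟨hx, hxu⟩ := (mem_freeEnds_erase_iff h hu).1 hx
      have hu' := mem_freeEnds_erase hu hxu.symm
      rw [erase_right_comm] at hy
      obtain ⟨hy, hyu⟩ := (mem_freeEnds_erase_iff h hu').1 hy
      exact ⟨hx, hy, mem_freeEnds_erase hu' hyu.symm⟩
    · rintro ⟨hx, hy, hu⟩
      obtain ⟨hu, huy⟩ := (mem_freeEnds_erase_iff h' hy).1 hu
      obtain ⟨hu', hux⟩ := (mem_freeEnds_erase_iff h' hx).1 hu
      refine ⟨hu', mem_freeEnds_erase hx hux.symm, ?_⟩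
      rw [erase_right_comm]
      exact mem_freeEnds_erase hy huy.symm
  rw [pullTerm, baseTerm, if_congr key rfl rfl]
  split_ifs with hc
  · obtain ⟨hu, -, hy⟩ := key.2 hc
    have hxX := hc.1
    have hyu : y ≠ u := fun e => ne_of_mem_freeEnds_erase hc.2.2 e.symm
    rw [posCount₃_cycle z X c u x y]
    simp only [transfer, hxX, if_true, mem_freeEnds_erase_iff h hu, hyu, and_true, ne_eq,
      not_false_eq_true]
    split_ifs <;> rfl
  · rfl

lemma pullTerm_sub_of_eq_left (c : Bool → ℕ) (v : β × Bool → ℝ) (h : ρ ≠ τ) :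
    pullTerm z X c v ρ ρ τ u x y - baseTerm z X c v ρ ρ τ u y x =
      if u ∈ freeEnds z ρ X ∧ x ∈ freeEnds z ρ X ∧ y ∈ freeEnds z τ X ∧ u ≠ x ∧ u ≠ y ∧ x ≠ y
      then posCount₃ z X c u x y * (v (y, τ) * (v (x, ρ) - v (u, ρ))) else 0 := by
  have h' := h.symm
  have key₁ : (u ∈ freeEnds z ρ X ∧ x ∈ freeEnds z ρ (X.erase u) ∧
      y ∈ freeEnds z τ ((X.erase u).erase x)) ↔ (u ∈ freeEnds z ρ X ∧
      x ∈ freeEnds z ρ (X.erase u) ∧ y ∈ freeEnds z τ X ∧ u ≠ y ∧ x ≠ y) := by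
    constructor
    · rintro ⟨hu, hx, hy⟩
      obtain ⟨hy, hyx⟩ := (mem_freeEnds_erase_iff h hx).1 hy
      obtain ⟨hy, hyu⟩ := (mem_freeEnds_erase_iff h hu).1 hy
      exact ⟨hu, hx, hy, hyu.symm, hyx.symm⟩
    · rintro ⟨hu, hx, hy, hyu, hyx⟩
      exact ⟨hu, hx, mem_freeEnds_erase (mem_freeEnds_erase hy hyu.symm) hyx.symm⟩
  have key₂ : (u ∈ freeEnds z ρ X ∧ y ∈ freeEnds z τ (X.erase u) ∧
      x ∈ freeEnds z ρ ((X.erase u).erase y)) ↔ (u ∈ freeEnds z ρ X ∧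
      x ∈ freeEnds z ρ (X.erase u) ∧ y ∈ freeEnds z τ X ∧ u ≠ y ∧ x ≠ y) := by
    constructor
    · rintro ⟨hu, hy, hx⟩
      obtain ⟨hx, hyx⟩ := (mem_freeEnds_erase_iff h' hy).1 hx
      obtain ⟨hy, hyu⟩ := (mem_freeEnds_erase_iff h hu).1 hy
      exact ⟨hu, hx, hy, hyu.symm, hyx⟩
    · rintro ⟨hu, hx, hy, hyu, hyx⟩
      exact ⟨hu, mem_freeEnds_erase hy hyu.symm, mem_freeEnds_erase hx hyx⟩
  rw [pullTerm, baseTerm, if_congr key₁ rfl rfl, if_congr key₂ rfl rfl,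
    show posCount₃ z X c u y x = posCount₃ z X c u x y from
      congrArg (posCount z · c) (erase_right_comm ..)]
  by_cases hc : u ∈ freeEnds z ρ X ∧ x ∈ freeEnds z ρ (X.erase u) ∧ y ∈ freeEnds z τ X ∧
    u ≠ y ∧ x ≠ y
  · obtain ⟨hu, hx, hy, huy, hxy⟩ := hc
    have hyu : y ∈ freeEnds z τ (X.erase u) := mem_freeEnds_erase hy huy.symm
    have hux : u ≠ x := (ne_of_mem_freeEnds_erase hx).symm
    by_cases hxX : x ∈ freeEnds z ρ X
    · simp [transfer, hu, hx, hy, huy, hxy, hyu, hxX, hux]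
      ring
    · simp [transfer, hu, hx, hy, huy, hxy, hyu, hxX]
  · rw [if_neg hc, if_neg hc, if_neg, sub_zero]
    rintro ⟨hu, hx, hy, hux, huy, hxy⟩
    exact hc ⟨hu, mem_freeEnds_erase hx hux.symm, hy, huy, hxy⟩

lemma pullTerm_sub_of_eq_right (c : Bool → ℕ) (v : β × Bool → ℝ) (h : ρ ≠ σ) :
    pullTerm z X c v ρ σ ρ u x y - baseTerm z X c v ρ σ ρ x u y =
      if u ∈ freeEnds z ρ X ∧ x ∈ freeEnds z σ X ∧ y ∈ freeEnds z ρ X ∧ u ≠ x ∧ u ≠ y ∧ x ≠ y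
      then posCount₃ z X c u x y * (v (x, σ) * (v (y, ρ) - v (u, ρ))) else 0 := by
  have h' := h.symm
  have key₁ : (u ∈ freeEnds z ρ X ∧ x ∈ freeEnds z σ (X.erase u) ∧
      y ∈ freeEnds z ρ ((X.erase u).erase x)) ↔ (u ∈ freeEnds z ρ X ∧
      x ∈ freeEnds z σ X ∧ y ∈ freeEnds z ρ (X.erase u) ∧ u ≠ x ∧ x ≠ y) := by
    constructor
    · rintro ⟨hu, hx, hy⟩
      obtain ⟨hy, hyx⟩ := (mem_freeEnds_erase_iff h' hx).1 hy
      obtain ⟨hx, hxu⟩ := (mem_freeEnds_erase_iff h hu).1 hx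
      exact ⟨hu, hx, hy, hxu.symm, hyx.symm⟩
    · rintro ⟨hu, hx, hy, hux, hyx⟩
      exact ⟨hu, mem_freeEnds_erase hx hux.symm, mem_freeEnds_erase hy hyx.symm⟩
  have key₂ : (x ∈ freeEnds z σ X ∧ u ∈ freeEnds z ρ (X.erase x) ∧
      y ∈ freeEnds z ρ ((X.erase x).erase u)) ↔ (u ∈ freeEnds z ρ X ∧
      x ∈ freeEnds z σ X ∧ y ∈ freeEnds z ρ (X.erase u) ∧ u ≠ x ∧ x ≠ y) := by
    rw [erase_right_comm, ← key₁]
    constructor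
    · rintro ⟨hx, hu, hy⟩
      obtain ⟨hu, hux⟩ := (mem_freeEnds_erase_iff h' hx).1 hu
      exact ⟨hu, mem_freeEnds_erase hx hux.symm, hy⟩
    · rintro ⟨hu, hx, hy⟩
      obtain ⟨hx, hxu⟩ := (mem_freeEnds_erase_iff h hu).1 hx
      exact ⟨hx, mem_freeEnds_erase hu hxu.symm, hy⟩
  rw [pullTerm, baseTerm, if_congr key₁ rfl rfl, if_congr key₂ rfl rfl, posCount₃_swap' z X c u x y]
  by_cases hc : u ∈ freeEnds z ρ X ∧ x ∈ freeEnds z σ X ∧ y ∈ freeEnds z ρ (X.erase u) ∧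
    u ≠ x ∧ x ≠ y
  · obtain ⟨hu, hx, hy, hux, hxy⟩ := hc
    have huy : u ≠ y := (ne_of_mem_freeEnds_erase hy).symm
    by_cases hyX : y ∈ freeEnds z ρ X
    · simp [transfer, hu, hx, hy, huy, hxy, hyX, hux]
      ring
    · simp [transfer, hu, hx, hy, hxy, hyX, hux]
  · rw [if_neg hc, if_neg hc, if_neg, sub_zero]
    rintro ⟨hu, hx, hy, hux, huy, hxy⟩
    exact hc ⟨hu, hx, mem_freeEnds_erase hy huy.symm, hux, hxy⟩

/-- The defect attached to `u`, `x` and an element `y` released by `u`. -/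
noncomputable def releaseTerm (z : β) (X : Finset β) (c : Bool → ℕ) (v : β × Bool → ℝ)
    (ρ : Bool) (u x y : β) : ℝ :=
  if u ∈ freeEnds z ρ X ∧ x ∉ freeEnds z ρ X ∧ x ∈ freeEnds z ρ (X.erase u) ∧
    y ∈ freeEnds z ρ X ∧ u ≠ y
  then posCount₃ z X c u x y * (v (u, ρ) * (v (y, ρ) - v (u, ρ))) else 0

/-- The defect attached to an element `y` released only by removing both `u` and `x`. -/
noncomputable def jointTerm (z : β) (X : Finset β) (c : Bool → ℕ) (v : β × Bool → ℝ)
    (ρ : Bool) (u x y : β) : ℝ :=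
  if u ∈ freeEnds z ρ X ∧ x ∈ freeEnds z ρ X ∧ u ≠ x ∧ y ∉ freeEnds z ρ (X.erase u) ∧
    y ∉ freeEnds z ρ (X.erase x) ∧ y ∈ freeEnds z ρ ((X.erase u).erase x)
  then posCount₃ z X c u x y * (v (x, ρ) * (v (x, ρ) - v (u, ρ))) else 0

lemma pullTerm_sub_of_eq_eq (c : Bool → ℕ) (v : β × Bool → ℝ) :
    pullTerm z X c v ρ ρ ρ u x y - baseTerm z X c v ρ ρ ρ u x y =
      (if u ∈ freeEnds z ρ X ∧ x ∈ freeEnds z ρ X ∧ y ∈ freeEnds z ρ X ∧ u ≠ x ∧ u ≠ y ∧ x ≠ y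
      then posCount₃ z X c u x y * (v (x, ρ) * (v (y, ρ) - v (u, ρ))) else 0) +
      (releaseTerm z X c v ρ u x y - releaseTerm z X c v ρ x y u) +
      jointTerm z X c v ρ u x y := by
  have e1 : posCount₃ z X c x y u = posCount₃ z X c u x y := posCount₃_cycle ..
  have m1 : ∀ {a b : β}, a ∈ freeEnds z ρ X → a ≠ b → a ∈ freeEnds z ρ (X.erase b) :=
    mem_freeEnds_erase
  by_cases hu : u ∈ freeEnds z ρ X
  swap
  · simp [pullTerm, baseTerm, releaseTerm, jointTerm, hu]
  by_cases hxu : x ∈ freeEnds z ρ (X.erase u)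
  swap
  · have hx : x ∈ freeEnds z ρ X → x = u := fun h => by_contra fun h' => hxu (m1 h h')
    by_cases hxX : x ∈ freeEnds z ρ X
    · obtain rfl := hx hxX
      simp [pullTerm, baseTerm, releaseTerm, jointTerm, hu, hxu]
    · simp [pullTerm, baseTerm, releaseTerm, jointTerm, hu, hxu, hxX]
  have hux : u ≠ x := (ne_of_mem_freeEnds_erase hxu).symm
  by_cases hxX : x ∈ freeEnds z ρ X
  · by_cases hyX : y ∈ freeEnds z ρ X
    · by_cases hyu : y = u
      · subst hyu
        have : y ∉ freeEnds z ρ ((X.erase y).erase x) := fun h =>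
          ne_of_mem_freeEnds_erase (erase_right_comm (s := X) (a := y) (b := x) ▸ h) rfl
        simp [pullTerm, baseTerm, releaseTerm, jointTerm, hxX, hyX, this]
      · by_cases hyx : y = x
        · subst hyx
          have : y ∉ freeEnds z ρ ((X.erase u).erase y) := fun h => ne_of_mem_freeEnds_erase h rfl
          simp [pullTerm, baseTerm, releaseTerm, jointTerm, hu, hyX, this]
        · have h1 := m1 hyX hyu
          have h2 := mem_freeEnds_erase h1 hyx
          have hyu' : ¬ u = y := Ne.symm hyu
          have hyx' : ¬ x = y := Ne.symm hyx
          simp [pullTerm, baseTerm, releaseTerm, jointTerm, transfer, hu, hxu, hxX, hyX, h1, h2,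
            hyu', hyx', hux]
          ring
    · by_cases hyu : y ∈ freeEnds z ρ (X.erase u)
      · have h3 : y ∉ freeEnds z ρ (X.erase x) := fun h =>
          hux (eq_of_mem_freeEnds_erase hyX hyu h)
        simp [pullTerm, baseTerm, releaseTerm, jointTerm, transfer, hu, hxX, hyX, hyu, h3]
        split_ifs <;> ring
      · by_cases hyx : y ∈ freeEnds z ρ (X.erase x)
        · have hyu' : y ≠ u := fun h => hyX (h ▸ hu)
          have h4 : y ∈ freeEnds z ρ ((X.erase u).erase x) := by
            rw [erase_right_comm]; exact mem_freeEnds_erase hyx hyu'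
          simp [pullTerm, baseTerm, releaseTerm, jointTerm, transfer, hu, hxX, hyX, hyu, hyx, h4,
            hux.symm, hxu, e1]
          ring
        · simp [pullTerm, baseTerm, releaseTerm, jointTerm, transfer, hu, hxX, hyX, hyu, hyx,
            hux, hxu]
          split_ifs <;> ring
  · by_cases hyX : y ∈ freeEnds z ρ X
    · by_cases hyu : y = u
      · subst hyu
        have : y ∉ freeEnds z ρ ((X.erase y).erase x) := fun h =>
          ne_of_mem_freeEnds_erase (erase_right_comm (s := X) (a := y) (b := x) ▸ h) rfl
        simp [pullTerm, baseTerm, releaseTerm, jointTerm, hxX, hyX, this]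
      · have hyx : y ≠ x := fun h => hxX (h ▸ hyX)
        have h1 := m1 hyX hyu
        have h2 := mem_freeEnds_erase h1 hyx
        have hyu' : ¬ u = y := Ne.symm hyu
        simp [pullTerm, baseTerm, releaseTerm, jointTerm, transfer, hu, hxu, hxX, hyX, h1, h2,
          hyu']
        ring
    · simp [pullTerm, baseTerm, releaseTerm, jointTerm, transfer, hu, hxu, hxX, hyX]

end Pullback

section PullbackSum
open scoped Classical
open Matrix

variable {β : Type*} [PartialOrder β] [Fintype β]

lemma sum_releaseTerm_sub (z : β) (X : Finset β) (c : Bool → ℕ) (v : β × Bool → ℝ) (ρ : Bool) :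
    ∑ u, ∑ x, ∑ y, (releaseTerm z X c v ρ u x y - releaseTerm z X c v ρ x y u) = 0 := by
  have h := sum_cycle (releaseTerm z X c v ρ)
  simp only [sum_sub_distrib]
  exact sub_eq_zero.2 h

lemma sum_jointTerm_nonneg (z : β) (X : Finset β) (c : Bool → ℕ) (v : β × Bool → ℝ) (ρ : Bool) :
    0 ≤ ∑ u, ∑ x, ∑ y, jointTerm z X c v ρ u x y := by
  have h : ∑ u, ∑ x, ∑ y, jointTerm z X c v ρ u x y =
      ∑ u, ∑ x, ∑ y, jointTerm z X c v ρ x u y := sum_comm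
  have h2 : 0 ≤ ∑ u, ∑ x, ∑ y, (jointTerm z X c v ρ u x y + jointTerm z X c v ρ x u y) := by
    refine sum_nonneg fun u _ => sum_nonneg fun x _ => sum_nonneg fun y _ => ?_
    simp only [jointTerm]
    by_cases hc : u ∈ freeEnds z ρ X ∧ x ∈ freeEnds z ρ X ∧ u ≠ x ∧
      y ∉ freeEnds z ρ (X.erase u) ∧ y ∉ freeEnds z ρ (X.erase x) ∧
      y ∈ freeEnds z ρ ((X.erase u).erase x)
    · have hc' : x ∈ freeEnds z ρ X ∧ u ∈ freeEnds z ρ X ∧ x ≠ u ∧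
          y ∉ freeEnds z ρ (X.erase x) ∧ y ∉ freeEnds z ρ (X.erase u) ∧
          y ∈ freeEnds z ρ ((X.erase x).erase u) := by
        rw [erase_right_comm]; tauto
      rw [if_pos hc, if_pos hc', posCount₃_swap' z X c u x y]
      nlinarith [mul_nonneg (posCount₃_nonneg z X c u x y)
        (sq_nonneg (v (x, ρ) - v (u, ρ)))]
    · have hc' : ¬ (x ∈ freeEnds z ρ X ∧ u ∈ freeEnds z ρ X ∧ x ≠ u ∧
          y ∉ freeEnds z ρ (X.erase x) ∧ y ∉ freeEnds z ρ (X.erase u) ∧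
          y ∈ freeEnds z ρ ((X.erase x).erase u)) := by
        rw [erase_right_comm]; tauto
      rw [if_neg hc, if_neg hc', add_zero]
  simp only [sum_add_distrib] at h2
  linarith

lemma sum_ends_eq_zero (z : β) (X : Finset β) (c : Bool → ℕ) (v : β × Bool → ℝ) (ρ σ : Bool) :
    ∑ u, ∑ x, ∑ y, (if u ∈ freeEnds z ρ X ∧ x ∈ freeEnds z σ X ∧ y ∈ freeEnds z ρ X ∧ u ≠ x ∧
      u ≠ y ∧ x ≠ y
      then posCount₃ z X c u x y * (v (x, σ) * (v (y, ρ) - v (u, ρ))) else 0) = 0 := by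
  refine sum_eq_zero_of_antisymm fun u x y => ?_
  rw [posCount₃_swap z X c u x y]
  split_ifs with h₁ h₂ h₂
  · ring
  · exact absurd ⟨h₁.2.2.1, h₁.2.1, h₁.1, h₁.2.2.2.2.2.symm, h₁.2.2.2.2.1.symm,
      h₁.2.2.2.1.symm⟩ h₂
  · exact absurd ⟨h₂.2.2.1, h₂.2.1, h₂.1, h₂.2.2.2.2.2.symm, h₂.2.2.2.2.1.symm,
      h₂.2.2.2.1.symm⟩ h₁
  · rw [neg_zero]

lemma sum_baseTerm_le_sum_pullTerm (z : β) (X : Finset β) (c : Bool → ℕ) (v : β × Bool → ℝ)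
    (ρ σ τ : Bool) :
    ∑ x, ∑ y, ∑ u, baseTerm z X c v ρ σ τ x y u ≤ ∑ u, ∑ x, ∑ y, pullTerm z X c v ρ σ τ u x y := by
  by_cases hσ : ρ = σ
  · subst hσ
    by_cases hτ : ρ = τ
    · subst hτ
      rw [← sub_nonneg]
      simp only [← sum_sub_distrib, pullTerm_sub_of_eq_eq]
      simp only [sum_add_distrib, sum_ends_eq_zero, sum_releaseTerm_sub, zero_add]
      exact sum_jointTerm_nonneg z X c v ρ
    · refine le_of_eq (Eq.symm (sub_eq_zero.1 ?_))
      have h : ∑ u, ∑ x, ∑ y, baseTerm z X c v ρ ρ τ u x y =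
        ∑ u, ∑ x, ∑ y, baseTerm z X c v ρ ρ τ u y x := sum_congr rfl fun u _ => sum_comm
      rw [h]
      simp only [← sum_sub_distrib, pullTerm_sub_of_eq_left c v hτ]
      rw [sum_congr rfl fun u _ => sum_comm]
      refine Eq.trans ?_ (sum_ends_eq_zero z X c v ρ τ)
      refine sum_congr rfl fun u _ => sum_congr rfl fun x _ => sum_congr rfl fun y _ => ?_
      rw [show posCount₃ z X c u y x = posCount₃ z X c u x y from
        congrArg (posCount z · c) (erase_right_comm ..)]
      refine if_congr ?_ rfl rfl
      rw [ne_comm (a := x) (b := y)]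
      tauto
  · by_cases hτ : ρ = τ
    · subst hτ
      refine le_of_eq (Eq.symm (sub_eq_zero.1 ?_))
      have h : ∑ u, ∑ x, ∑ y, baseTerm z X c v ρ σ ρ u x y =
        ∑ u, ∑ x, ∑ y, baseTerm z X c v ρ σ ρ x u y := sum_comm
      rw [h]
      simp only [← sum_sub_distrib, pullTerm_sub_of_eq_right c v hσ]
      exact sum_ends_eq_zero z X c v ρ σ
    · obtain rfl : σ = τ := by revert hσ hτ; cases ρ <;> cases σ <;> cases τ <;> simp
      rw [sum_cycle (baseTerm z X c v ρ σ σ)]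
      simp only [pullTerm_eq_of_ne c v hσ, le_refl]

lemma atlasMat_pullback (z : β) (X : Finset β) (c : Bool → ℕ) (v : β × Bool → ℝ) (ρ : Bool) :
    v ⬝ᵥ atlasMat z X (c + Pi.single ρ 1) *ᵥ v ≤ ∑ u ∈ freeEnds z ρ X,
      transfer z X (u, ρ) v ⬝ᵥ atlasMat z (X.erase u) c *ᵥ transfer z X (u, ρ) v := by
  have h1 : v ⬝ᵥ atlasMat z X (c + Pi.single ρ 1) *ᵥ v =
      ∑ σ, ∑ τ, ∑ x, ∑ y, ∑ u, baseTerm z X c v ρ σ τ x y u := by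
    rw [dotProduct_atlasMat_mulVec]
    refine sum_congr rfl fun σ _ => ?_
    simp only [endForm, mul_sum]
    rw [sum_comm]
    refine sum_congr rfl fun τ _ => ?_
    simp only [baseTerm]
    rw [← sum_dependent]
    refine sum_congr rfl fun x _ => sum_congr rfl fun y _ => ?_
    rw [posCount_add_single, sum_mul, mul_sum]
    refine sum_congr rfl fun u _ => ?_
    rw [posCount₃]
    ring
  have h2 : ∑ u ∈ freeEnds z ρ X,
      transfer z X (u, ρ) v ⬝ᵥ atlasMat z (X.erase u) c *ᵥ transfer z X (u, ρ) v =
      ∑ σ, ∑ τ, ∑ u, ∑ x, ∑ y, pullTerm z X c v ρ σ τ u x y := by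
    simp only [dotProduct_atlasMat_mulVec, endForm]
    rw [sum_comm]
    refine sum_congr rfl fun σ _ => ?_
    simp only [mul_sum]
    rw [sum_congr rfl fun u _ => sum_comm, sum_comm]
    refine sum_congr rfl fun τ _ => ?_
    simp only [pullTerm]
    rw [← sum_dependent]
    refine sum_congr rfl fun u _ => sum_congr rfl fun x _ => sum_congr rfl fun y _ => ?_
    rw [posCount₃]
    ring
  rw [h1, h2]
  exact sum_le_sum fun σ _ => sum_le_sum fun τ _ => sum_baseTerm_le_sum_pullTerm z X c v ρ σ τ

end PullbackSum

section Positivity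
open scoped Classical
open Matrix

variable {β : Type*} [PartialOrder β]

/-- The number of elements of `Y` below (`σ = true`) or above (`σ = false`) the element `z`. -/
noncomputable def sideCount (z : β) (σ : Bool) (Y : Finset β) : ℕ := #{y ∈ Y | before σ y z}

lemma sideCount_erase_le (z : β) (σ : Bool) (Y : Finset β) (m : β) :
    sideCount z σ (Y.erase m) ≤ sideCount z σ Y :=
  card_le_card (filter_subset_filter _ (erase_subset _ _))

lemma sideCount_le_erase_add_one (z : β) (σ : Bool) (Y : Finset β) (m : β) :
    sideCount z σ Y ≤ sideCount z σ (Y.erase m) + 1 := by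
  rw [sideCount, sideCount, filter_erase]
  have := pred_card_le_card_erase (s := {y ∈ Y | before σ y z}) (a := m)
  omega

lemma sideCount_erase_of_before {z : β} {σ : Bool} {Y : Finset β} {m : β} (hm : m ∈ Y)
    (hmz : before σ m z) : sideCount z σ (Y.erase m) + 1 = sideCount z σ Y := by
  rw [sideCount, sideCount, filter_erase]
  exact card_erase_add_one (mem_filter.2 ⟨hm, hmz⟩)

lemma sideCount_erase_of_not {z : β} {σ : Bool} {Y : Finset β} {m : β}
    (hmz : ¬ before σ m z) : sideCount z σ (Y.erase m) = sideCount z σ Y := by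
  rw [sideCount, sideCount, filter_erase, erase_eq_of_notMem]
  exact fun h => hmz (mem_filter.1 h).2

lemma not_before_of_mem_freeEnds {z : β} {σ : Bool} {Y : Finset β} {m : β} (hz : z ∈ Y)
    (hm : m ∈ freeEnds z σ Y) : ¬ before (!σ) m z := by
  rw [before_not]
  exact (mem_freeEnds.1 hm).2.2 z hz

lemma before_asymm {σ : Bool} {a b : β} (h : before σ a b) : ¬ before σ b a :=
  fun h' => before_irrefl σ a (before_trans h h')

lemma exists_freeEnds_before {z : β} {σ : Bool} {Y : Finset β} (h : 0 < sideCount z σ Y) :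
    ∃ m ∈ freeEnds z σ Y, before σ m z := by
  obtain ⟨m, hm⟩ := exists_mem_ends σ {y ∈ Y | before σ y z} (card_pos.1 h)
  rw [mem_ends, mem_filter] at hm
  refine ⟨m, mem_freeEnds.2 ⟨?_, hm.1.1, fun y hy hym => ?_⟩, hm.1.2⟩
  · rintro rfl
    exact before_irrefl _ _ hm.1.2
  · exact hm.2 y (mem_filter.2 ⟨hy, before_trans hym hm.1.2⟩) hym

lemma exists_freeEnds {z : β} {σ : Bool} {Y : Finset β} (hz : z ∈ Y)
    (h : sideCount z (!σ) Y + 1 < #Y) : (freeEnds z σ Y).Nonempty := by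
  have hne : (Y.erase z \ {y ∈ Y | before (!σ) y z}).Nonempty := by
    rw [← card_pos]
    have h1 := le_card_sdiff {y ∈ Y | before (!σ) y z} (Y.erase z)
    rw [card_erase_of_mem hz] at h1
    rw [sideCount] at h
    omega
  obtain ⟨m, hm⟩ := exists_mem_ends σ _ hne
  simp only [mem_ends, mem_sdiff, mem_erase, mem_filter, before_not, not_and] at hm
  refine ⟨m, mem_freeEnds.2 ⟨hm.1.1.1, hm.1.1.2, fun y hy hym => ?_⟩⟩
  have hzm := hm.1.2 hm.1.1.2
  refine hm.2 y ⟨⟨?_, hy⟩, fun _ hzy => hzm (before_trans hzy hym)⟩ hym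
  rintro rfl
  exact hzm hym

lemma posCount_add_single_pos {z : β} {Y : Finset β} {c : Bool → ℕ} {σ : Bool} :
    0 < posCount z Y (c + Pi.single σ 1) ↔
      ∃ m ∈ freeEnds z σ Y, 0 < posCount z (Y.erase m) c := by
  rw [posCount_add_single, sum_pos_iff_of_nonneg fun m _ => posCount_nonneg _ _ _]

lemma posCount_singleton (z : β) : posCount z {z} 0 = 1 := by
  have h : linLists ({z} : Finset β) = {[z]} := by
    ext l
    rw [mem_singleton]
    constructor
    · intro hl
      have h1 := length_of_mem_linLists hl
      rw [card_singleton, List.length_eq_one_iff] at h1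
      obtain ⟨a, rfl⟩ := h1
      have := ((mem_linLists.1 hl).2.1 a).1 (by simp)
      rw [mem_singleton.1 this]
    · rintro rfl
      exact mem_linLists.2 ⟨List.nodup_singleton z, by simp, by simp⟩
  rw [posCount, h, filter_singleton, if_pos (by simp)]
  simp

lemma exists_add_single {c : Bool → ℕ} {n : ℕ} (hc : c true + c false = n + 1) :
    ∃ (c' : Bool → ℕ) (σ : Bool), c = c' + Pi.single σ 1 ∧ c' true + c' false = n := by
  obtain ⟨σ, hσ⟩ : ∃ σ, 1 ≤ c σ := by
    by_contra! h
    have h1 := h true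
    have h2 := h false
    omega
  refine ⟨c - Pi.single σ 1, σ, ?_, ?_⟩
  · refine (tsub_add_cancel_of_le fun τ => ?_).symm
    by_cases h : τ = σ
    · subst h; simpa using hσ
    · simp [h]
  · cases σ <;> simp <;> omega

lemma posCount_pos_iff {z : β} {Y : Finset β} {c : Bool → ℕ} (hz : z ∈ Y)
    (hY : #Y = c true + c false + 1) :
    0 < posCount z Y c ↔ ∀ σ, sideCount z σ Y ≤ c σ := by
  obtain ⟨n, hn⟩ : ∃ n, c true + c false = n := ⟨_, rfl⟩
  induction n generalizing c Y with
  | zero =>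
    obtain rfl : c = 0 := by
      ext σ
      cases σ
      · exact (Nat.add_eq_zero_iff.1 hn).2
      · exact (Nat.add_eq_zero_iff.1 hn).1
    obtain ⟨a, rfl⟩ := card_eq_one.1 hY
    obtain rfl := mem_singleton.1 hz
    rw [posCount_singleton]
    simp [sideCount, filter_singleton, before_irrefl]
  | succ n ih =>
    obtain ⟨c', σ, rfl, hc'⟩ := exists_add_single hn
    rw [posCount_add_single_pos]
    have ih' : ∀ m ∈ freeEnds z σ Y, (0 < posCount z (Y.erase m) c' ↔
        ∀ τ, sideCount z τ (Y.erase m) ≤ c' τ) := by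
      intro m hm
      have hm' := mem_freeEnds.1 hm
      refine ih (mem_erase.2 ⟨hm'.1.symm, hz⟩) ?_ hc'
      rw [card_erase_of_mem hm'.2.1, hY, hn, hc', Nat.add_sub_cancel]
    constructor
    · rintro ⟨m, hm, hpos⟩ τ
      have h1 := (ih' m hm).1 hpos τ
      by_cases hτ : τ = σ
      · subst hτ
        have := sideCount_le_erase_add_one z τ Y m
        simp only [Pi.add_apply, Pi.single_eq_same]
        omega
      · obtain rfl : τ = !σ := by revert hτ; cases σ <;> cases τ <;> simp
        rw [sideCount_erase_of_not (not_before_of_mem_freeEnds hz hm)] at h1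
        simpa using h1
    · intro h
      have hσ : sideCount z σ Y ≤ c' σ + 1 := by simpa using h σ
      have hσ' : sideCount z (!σ) Y ≤ c' (!σ) := by simpa using h (!σ)
      have hsum : c' σ + c' (!σ) = n := by cases σ <;> simp <;> omega
      obtain ⟨m, hm, hmz⟩ : ∃ m ∈ freeEnds z σ Y, sideCount z σ (Y.erase m) ≤ c' σ := by
        by_cases h0 : 0 < sideCount z σ Y
        · obtain ⟨m, hm, hmz⟩ := exists_freeEnds_before h0
          refine ⟨m, hm, ?_⟩
          have := sideCount_erase_of_before (mem_freeEnds.1 hm).2.1 hmz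
          omega
        · obtain ⟨m, hm⟩ := exists_freeEnds (σ := σ) hz (by omega)
          refine ⟨m, hm, ?_⟩
          have := sideCount_erase_le z σ Y m
          omega
      refine ⟨m, hm, (ih' m hm).2 fun τ => ?_⟩
      by_cases hτ : τ = σ
      · exact hτ ▸ hmz
      · obtain rfl : τ = !σ := by revert hτ; cases σ <;> cases τ <;> simp
        exact (sideCount_erase_le z _ Y m).trans hσ'

end Positivity

section HyperbolicStep
open scoped Classical
open Matrix

lemma exists_pos_of_sum_pos' {ι : Type*} {s : Finset ι} {f : ι → ℝ} (h : 0 < ∑ i ∈ s, f i) :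
    ∃ i ∈ s, 0 < f i :=
  exists_lt_of_sum_lt (f := fun _ => (0 : ℝ)) (by simpa using h)

variable {β : Type*} [PartialOrder β]

lemma stepMat_pos {z : β} {X : Finset β} {c : Bool → ℕ} {h : Bool → ℝ} (hh : ∀ ρ, 0 < h ρ)
    (hz : z ∈ X) (hX : #X = c true + c false + 4) {i j : β × Bool}
    (hi : i.1 ∈ freeEnds z i.2 X) (hj : j.1 ∈ freeEnds z j.2 X) (hij : i.1 ≠ j.1) (ρ : Bool)
    (hρ : ∀ κ, sideCount z κ ((X.erase j.1).erase i.1) ≤ (c + Pi.single ρ 1 : Bool → ℕ) κ) :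
    0 < stepMat z X c h i j := by
  rw [stepMat, Matrix.sum_apply]
  refine sum_pos' (fun τ _ => mul_nonneg (hh τ).le (atlasMat_nonneg _ _ _ _ _))
    ⟨ρ, mem_univ _, mul_pos (hh ρ) ?_⟩
  have hne : i ≠ j := fun h => hij (congrArg Prod.fst h)
  simp only [atlasMat, hi, hj, hij, hne, true_and, ne_eq, not_false_eq_true, if_true, false_and,
    if_false, add_zero]
  have hi' := mem_freeEnds.1 hi
  have hj' := mem_freeEnds.1 hj
  rw [erase_right_comm, posCount_pos_iff]
  · exact hρ
  · exact mem_erase.2 ⟨hi'.1.symm, mem_erase.2 ⟨hj'.1.symm, hz⟩⟩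
  · rw [card_erase_of_mem (mem_erase.2 ⟨hij, hi'.2.1⟩), card_erase_of_mem hj'.2.1, hX]
    cases ρ <;> simp <;> omega

variable [Fintype β]

lemma exists_sideCount_le_of_mulVec_pos {z : β} {X : Finset β} {c : Bool → ℕ} {h : Bool → ℝ}
    (hz : z ∈ X) (hX : #X = c true + c false + 4) {i : β × Bool}
    (hi : 0 < (stepMat z X c h *ᵥ fun p => h p.2) i) (hh : ∀ ρ, 0 < h ρ) :
    i.1 ∈ freeEnds z i.2 X ∧ ∃ ρ τ, ∀ κ, sideCount z κ (X.erase i.1) ≤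
      (c + Pi.single ρ 1 + Pi.single τ 1 : Bool → ℕ) κ := by
  rw [stepMat_mulVec_side] at hi
  split_ifs at hi with hfree
  · refine ⟨hfree, ?_⟩
    rw [← sum_mul_endForm] at hi
    obtain ⟨ρ, -, hρ⟩ := exists_pos_of_sum_pos' hi
    obtain ⟨τ, -, hτ⟩ := exists_pos_of_sum_pos' (pos_of_mul_pos_right hρ (hh ρ).le)
    obtain ⟨y, hy, hy'⟩ := exists_pos_of_sum_pos' hτ
    have hpos : 0 < posCount z (X.erase i.1) (c + Pi.single ρ 1 + Pi.single τ 1) :=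
      posCount_add_single_pos.2 ⟨y, hy, pos_of_mul_pos_left hy' (hh τ).le⟩
    have hi' := mem_freeEnds.1 hfree
    refine ⟨ρ, τ, (posCount_pos_iff (mem_erase.2 ⟨hi'.1.symm, hz⟩) ?_).1 hpos⟩
    rw [card_erase_of_mem hi'.2.1, hX]
    cases ρ <;> cases τ <;> simp <;> omega
  · exact absurd hi (lt_irrefl _)

lemma stepMat_connected {z : β} {X : Finset β} {c : Bool → ℕ} {h : Bool → ℝ}
    (hh : ∀ ρ, 0 < h ρ) (hz : z ∈ X) (hX : #X = c true + c false + 4) (f : β × Bool → ℝ)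
    (hf : ∀ i j, 0 < stepMat z X c h i j → f i = f j) (i j : β × Bool)
    (hi : 0 < (stepMat z X c h *ᵥ fun p => h p.2) i)
    (hj : 0 < (stepMat z X c h *ᵥ fun p => h p.2) j) : f i = f j := by
  by_cases hcase : ∃ σ, c σ + 1 ≤ sideCount z σ X ∧
      (c σ + 2 ≤ sideCount z σ X ∨ sideCount z (!σ) X ≤ c (!σ) + 1)
  · obtain ⟨σ, hσ, hσ'⟩ := hcase
    obtain ⟨x, hx, hxz⟩ := exists_freeEnds_before (z := z) (σ := σ) (Y := X) (by omega)
    have hub : ∀ j, 0 < (stepMat z X c h *ᵥ fun p => h p.2) j → f (x, σ) = f j := by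
      rintro ⟨y, τ⟩ hj
      obtain ⟨hy, ρ, ρ', hle⟩ := exists_sideCount_le_of_mulVec_pos hz hX hj hh
      by_cases hxy : x = y
      · subst hxy
        congr 2
        by_contra hστ
        obtain rfl : τ = !σ := by revert hστ; cases σ <;> cases τ <;> simp
        exact not_before_of_mem_freeEnds hz hy (by simpa using hxz)
      · have e1 := sideCount_erase_of_before (z := z) (Y := X.erase y)
          (mem_erase.2 ⟨hxy, (mem_freeEnds.1 hx).2.1⟩) hxz
        have e2 := sideCount_erase_le z (!σ) (X.erase y) x
        have e3 := sideCount_erase_le z (!σ) X y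
        have e4 := sideCount_le_erase_add_one z σ X y
        have h1 := hle σ
        have h2 := hle (!σ)
        simp only [Pi.add_apply] at h1 h2
        have cover : ∀ κ, κ = σ ∨ κ = !σ := by cases σ <;> simp
        have step : ∀ ρ'' : Bool,
            sideCount z σ ((X.erase y).erase x) ≤ (c + Pi.single ρ'' 1 : Bool → ℕ) σ →
            sideCount z (!σ) ((X.erase y).erase x) ≤ (c + Pi.single ρ'' 1 : Bool → ℕ) (!σ) →
            f (x, σ) = f (y, τ) := by
          intro ρ'' ha hb
          refine hf _ _ (stepMat_pos hh hz hX hx hy hxy ρ'' fun κ => ?_)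
          rcases cover κ with rfl | rfl
          · exact ha
          · exact hb
        by_cases hlarge : c σ + 1 ≤ sideCount z σ (X.erase y)
        · rcases cover ρ with rfl | rfl
          · refine step ρ' ?_ ?_ <;> simp only [Pi.add_apply] <;> simp at h1 h2 e1 ⊢ <;> omega
          · refine step (!σ) ?_ ?_ <;> rcases cover ρ' with rfl | rfl <;>
              simp only [Pi.add_apply] <;> simp at h1 h2 e1 ⊢ <;> omega
        · refine step (!σ) ?_ ?_ <;> simp only [Pi.add_apply] <;> simp at e1 ⊢ <;> omega
    rw [← hub i hi, ← hub j hj]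
  · have hle : ∀ σ, sideCount z σ X ≤ c σ := by
      intro σ
      by_contra hlt
      by_cases h' : sideCount z (!σ) X ≤ c (!σ) + 1
      · exact hcase ⟨σ, by omega, Or.inr h'⟩
      · exact hcase ⟨!σ, by omega, Or.inl (by omega)⟩
    have key : ∀ i j : β × Bool, i.1 ∈ freeEnds z i.2 X → j.1 ∈ freeEnds z j.2 X → i.1 ≠ j.1 →
        f i = f j := by
      intro i j hi hj hij
      refine hf i j (stepMat_pos hh hz hX hi hj hij true fun κ => ?_)
      have h1 := sideCount_erase_le z κ (X.erase j.1) i.1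
      have h2 := sideCount_erase_le z κ X j.1
      have h3 := hle κ
      simp only [Pi.add_apply]
      omega
    obtain ⟨x, σ⟩ := i
    obtain ⟨y, τ⟩ := j
    have hx := (exists_sideCount_le_of_mulVec_pos hz hX hi hh).1
    have hy := (exists_sideCount_le_of_mulVec_pos hz hX hj hh).1
    by_cases hxy : x = y
    · subst hxy
      by_cases hστ : σ = τ
      · rw [hστ]
      obtain rfl : τ = !σ := by revert hστ; cases σ <;> cases τ <;> simp
      have hxX := mem_freeEnds.1 hx
      obtain ⟨y, hy'⟩ := exists_freeEnds (z := z) (σ := σ) (Y := X.erase x)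
        (mem_erase.2 ⟨hxX.1.symm, hz⟩) (by
          have h2 := sideCount_erase_le z (!σ) X x
          have h3 := hle (!σ)
          have h4 : c (!σ) ≤ c true + c false := by cases σ <;> simp
          rw [card_erase_of_mem hxX.2.1, hX]
          omega)
      have hy'' := (mem_freeEnds_erase_iff (Ne.symm hστ) hy).1 hy'
      rw [key (x, σ) (y, σ) hx hy''.1 hy''.2.symm, key (y, σ) (x, !σ) hy''.1 hy hy''.2]
    · exact key _ _ hx hy hxy

lemma stepMat_pullback (z : β) (X : Finset β) (c : Bool → ℕ) {h : Bool → ℝ} (hh : ∀ ρ, 0 < h ρ)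
    (v : β × Bool → ℝ) :
    v ⬝ᵥ stepMat z X c h *ᵥ v ≤ ∑ i : β × Bool, h i.2 * (if i.1 ∈ freeEnds z i.2 X then
      transfer z X i v ⬝ᵥ atlasMat z (X.erase i.1) c *ᵥ transfer z X i v else 0) := by
  simp only [mul_ite, mul_zero]
  rw [sum_sides (fun σ => freeEnds z σ X) fun i => h i.2 *
    (transfer z X i v ⬝ᵥ atlasMat z (X.erase i.1) c *ᵥ transfer z X i v), stepMat, sum_mulVec,
    dotProduct_sum]
  refine sum_le_sum fun ρ _ => ?_
  rw [smul_mulVec, dotProduct_smul, smul_eq_mul]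
  refine (mul_le_mul_of_nonneg_left (atlasMat_pullback z X c v ρ) (hh ρ).le).trans_eq ?_
  rw [mul_sum]

lemma stepMat_hyperbolic {z : β} {X : Finset β} {c : Bool → ℕ} {h : Bool → ℝ}
    (hh : ∀ ρ, 0 < h ρ) (hz : z ∈ X) (hX : #X = c true + c false + 4)
    (ih : ∀ x ∈ X, x ≠ z → Hyperbolic (atlasMat z (X.erase x) c)) :
    Hyperbolic (stepMat z X c h) := by
  have hzero : ∀ i : β × Bool, i.1 ∈ freeEnds z i.2 X →
      (stepMat z X c h *ᵥ fun p => h p.2) i = 0 → atlasMat z (X.erase i.1) c = 0 := by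
    intro i hi h0
    rw [stepMat_mulVec_side, if_pos hi] at h0
    have hnn := atlasMat_nonneg z (X.erase i.1) c
    have hrow : ∀ k : β × Bool, 0 ≤ h k.2 * (atlasMat z (X.erase i.1) c *ᵥ fun p => h p.2) k :=
      fun k => mul_nonneg (hh _).le (sum_nonneg fun j _ => mul_nonneg (hnn k j) (hh _).le)
    ext k j
    refine mulVec_eq_zero_of_row hnn (h := fun p => h p.2) (fun p => hh p.2) ?_ j
    exact (mul_eq_zero.1 ((sum_eq_zero_iff_of_nonneg fun k _ => hrow k).1 h0 k
      (mem_univ k))).resolve_left (hh _).ne'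
  refine hyperbolic_of_atlas (stepMat_isSymm z X c h) (stepMat_nonneg z X c hh)
    (h := fun p => h p.2) (fun p => hh p.2) (fun i v => if i.1 ∈ freeEnds z i.2 X then
      transfer z X i v ⬝ᵥ atlasMat z (X.erase i.1) c *ᵥ transfer z X i v else 0) ?_ ?_
    (stepMat_pullback z X c hh) (stepMat_connected hh hz hX)
  · intro i v h0
    by_cases hi : i.1 ∈ freeEnds z i.2 X
    · simp [hzero i hi h0]
    · simp [hi]
  · intro i v
    by_cases hi : i.1 ∈ freeEnds z i.2 X
    · by_cases h0 : (stepMat z X c h *ᵥ fun p => h p.2) i = 0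
      · rw [h0, mul_zero]
        positivity
      · have hpos : 0 < (stepMat z X c h *ᵥ fun p => h p.2) i :=
          lt_of_le_of_ne (sum_nonneg fun j _ => mul_nonneg (stepMat_nonneg z X c hh i j) (hh _).le)
            (Ne.symm h0)
        rw [stepMat_mulVec_side, if_pos hi] at hpos ⊢
        rw [stepMat_mulVec, if_pos hi, if_pos hi]
        have hi' := mem_freeEnds.1 hi
        exact ih i.1 hi'.2.1 hi'.1 _ _ hpos
    · rw [if_neg hi, zero_mul]
      positivity

end HyperbolicStep

section LogConcave
open scoped Classical
open Matrix Filter Topology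

lemma Hyperbolic.of_add_smul {ι : Type*} [Fintype ι] {A B : Matrix ι ι ℝ}
    (h : ∀ s : ℝ, 0 < s → Hyperbolic (A + s • B)) : Hyperbolic A := by
  intro v w hw
  have lim : ∀ v w : ι → ℝ, Tendsto (fun s : ℝ => v ⬝ᵥ (A + s • B) *ᵥ w) (𝓝[>] 0)
      (𝓝 (v ⬝ᵥ A *ᵥ w)) := by
    intro v w
    have hc : Continuous fun s : ℝ => v ⬝ᵥ (A + s • B) *ᵥ w := by
      simp only [add_mulVec, smul_mulVec, dotProduct_add, dotProduct_smul]
      fun_prop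
    simpa using (hc.tendsto 0).mono_left nhdsWithin_le_nhds
  refine le_of_tendsto_of_tendsto ((lim v v).mul (lim w w)) ((lim v w).pow 2) ?_
  filter_upwards [(lim w w).eventually_const_lt hw, self_mem_nhdsWithin] with s hs hs0
  exact h s hs0 v w hs

variable {β : Type*} [PartialOrder β]

lemma endForm_pair {z y : β} (hyz : y ≠ z) (u : β × Bool → ℝ) :
    endForm z {y, z} 0 u = ∑ τ, if y ∈ freeEnds z τ {y, z} then u (y, τ) else 0 := by
  refine sum_congr rfl fun τ _ => ?_
  have h1 : ∀ a ∈ freeEnds z τ {y, z}, a = y := by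
    intro a ha
    have ha := mem_freeEnds.1 ha
    simpa [ha.1] using ha.2.1
  split_ifs with h
  · have he : ({y, z} : Finset β).erase y = {z} := erase_insert (by simpa using hyz)
    rw [eq_singleton_iff_unique_mem.2 ⟨h, h1⟩, sum_singleton, he, posCount_singleton, one_mul]
  · rw [eq_empty_of_forall_notMem fun a ha => h (h1 a ha ▸ ha), sum_empty]

/-- The sum of the values of `v` at the sides where `x` is a free end of `X`. -/
noncomputable def endSum (z : β) (X : Finset β) (x : β) (v : β × Bool → ℝ) : ℝ :=
  ∑ σ, if x ∈ freeEnds z σ X then v (x, σ) else 0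

lemma exists_endSum_eq {z x y : β} {X : Finset β} (hyz : y ≠ z)
    (hX : X.erase x = {y, z}) : ∃ k : ℝ, 0 ≤ k ∧ k ≤ 1 ∧ ∀ v w : β × Bool → ℝ,
      (∑ σ, if x ∈ freeEnds z σ X then
        v (x, σ) * endForm z (X.erase x) 0 (transfer z X (x, σ) w) else 0) =
      endSum z X x v * endSum z X y w + k * (endSum z X x v * endSum z X x w) := by
  have hy : y ∈ X.erase x := by rw [hX]; simp
  have hxy : y ≠ x := (mem_erase.1 hy).1
  have hlift : ∀ τ, y ∈ freeEnds z τ (X.erase x) → ¬ before τ x y → y ∈ freeEnds z τ X := by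
    intro τ h hb
    rw [mem_freeEnds] at h ⊢
    refine ⟨h.1, mem_of_mem_erase h.2.1, fun w hw hwy => ?_⟩
    by_cases hwx : w = x
    · exact hb (hwx ▸ hwy)
    · exact h.2.2 w (mem_erase.2 ⟨hwx, hw⟩) hwy
  by_cases hcase : ∃ τ, y ∈ freeEnds z τ (X.erase x) ∧ y ∉ freeEnds z τ X
  · obtain ⟨τ, h1, h2⟩ := hcase
    have hb : before τ x y := by_contra fun hb => h2 (hlift τ h1 hb)
    have hx' : x ∉ freeEnds z (!τ) X := fun h =>
      (mem_freeEnds.1 h).2.2 y (mem_of_mem_erase hy) (before_not.2 hb)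
    have h3 : y ∈ freeEnds z (!τ) (X.erase x) ↔ y ∈ freeEnds z (!τ) X :=
      ⟨fun h => hlift _ h fun hb' => before_asymm hb (before_not.1 hb'),
        fun h => mem_freeEnds_erase h hxy⟩
    refine ⟨1, zero_le_one, le_rfl, fun v w => ?_⟩
    rw [hX] at h1 h3 ⊢
    simp only [endForm_pair hyz, endSum, Fintype.sum_bool, transfer]
    cases τ <;> simp only [Bool.not_true, Bool.not_false] at h3 hx' <;>
      simp only [h1, h2, hx', h3, if_true, if_false] <;> split_ifs <;> ring
  · have h3 : ∀ τ, y ∈ freeEnds z τ (X.erase x) ↔ y ∈ freeEnds z τ X := fun τ =>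
      ⟨fun h => by_contra fun h' => hcase ⟨τ, h, h'⟩, fun h => mem_freeEnds_erase h hxy⟩
    refine ⟨0, le_rfl, zero_le_one, fun v w => ?_⟩
    rw [hX] at h3 ⊢
    simp only [endForm_pair hyz, endSum, Fintype.sum_bool, transfer, h3]
    split_ifs <;> ring

variable [Fintype β]

lemma atlasMat_hyperbolic_of_card_eq_three {z : β} {X : Finset β} (hz : z ∈ X) (hX : #X = 3) :
    Hyperbolic (atlasMat z X 0) := by
  obtain ⟨x, y, hxy, hxyz⟩ := card_eq_two.1 (by rw [card_erase_of_mem hz, hX] : #(X.erase z) = 2)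
  have hx : x ∈ X.erase z := by rw [hxyz]; simp
  have hy : y ∈ X.erase z := by rw [hxyz]; simp
  rw [mem_erase] at hx hy
  obtain rfl : X = {x, y, z} := by
    rw [← insert_erase hz, hxyz]
    ext a
    simp only [mem_insert, mem_singleton]
    tauto
  have hex : ({x, y, z} : Finset β).erase x = {y, z} := erase_insert (by simp [hxy, hx.1])
  have hey : ({x, y, z} : Finset β).erase y = {x, z} := by
    rw [Finset.insert_comm]
    exact erase_insert (by simp [hxy.symm, hy.1])
  obtain ⟨k, hk0, hk1, hk⟩ := exists_endSum_eq hy.1 hex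
  obtain ⟨k', hk0', hk1', hk'⟩ := exists_endSum_eq hx.1 hey
  have hform : ∀ v w, v ⬝ᵥ atlasMat z {x, y, z} 0 *ᵥ w =
      (endSum z {x, y, z} x v * endSum z {x, y, z} y w +
        k * (endSum z {x, y, z} x v * endSum z {x, y, z} x w)) +
      (endSum z {x, y, z} y v * endSum z {x, y, z} x w +
        k' * (endSum z {x, y, z} y v * endSum z {x, y, z} y w)) := by
    intro v w
    rw [dotProduct_atlasMat_mulVec, ← hk, ← hk', ← sum_add_distrib]
    refine sum_congr rfl fun σ _ => ?_
    have hfree : freeEnds z σ {x, y, z} =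
        {a ∈ ({x, y} : Finset β) | a ∈ freeEnds z σ {x, y, z}} := by
      ext a
      rw [mem_filter]
      refine ⟨fun h => ⟨?_, h⟩, fun h => h.2⟩
      rw [← hxyz]
      exact mem_erase.2 ⟨(mem_freeEnds.1 h).1, (mem_freeEnds.1 h).2.1⟩
    conv_lhs => rw [hfree]
    rw [sum_filter, sum_pair hxy]
  intro v w _
  simp only [hform]
  have hkk : k * k' ≤ 1 := mul_le_one₀ hk1 hk0' hk1'
  nlinarith [mul_nonneg (sub_nonneg.2 hkk) (sq_nonneg
    (endSum z {x, y, z} x v * endSum z {x, y, z} y w -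
      endSum z {x, y, z} y v * endSum z {x, y, z} x w))]

/-- The matrices of the combinatorial atlas of linear extensions are hyperbolic. -/
theorem atlasMat_hyperbolic {z : β} {X : Finset β} {c : Bool → ℕ} (hz : z ∈ X)
    (hX : #X = c true + c false + 3) : Hyperbolic (atlasMat z X c) := by
  obtain ⟨n, hn⟩ : ∃ n, c true + c false = n := ⟨_, rfl⟩
  induction n generalizing c X with
  | zero =>
    obtain rfl : c = 0 := by
      ext σ
      cases σ
      · exact (Nat.add_eq_zero_iff.1 hn).2
      · exact (Nat.add_eq_zero_iff.1 hn).1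
    exact atlasMat_hyperbolic_of_card_eq_three hz hX
  | succ n ih =>
    obtain ⟨c', ρ, rfl, hc'⟩ := exists_add_single hn
    refine Hyperbolic.of_add_smul (B := atlasMat z X (c' + Pi.single (!ρ) 1)) fun s hs => ?_
    have hstep : stepMat z X c' (fun τ => if τ = ρ then 1 else s) =
        atlasMat z X (c' + Pi.single ρ 1) + s • atlasMat z X (c' + Pi.single (!ρ) 1) := by
      rw [stepMat, Fintype.sum_bool]
      cases ρ <;> simp [add_comm]
    rw [← hstep]
    refine stepMat_hyperbolic (fun τ => ?_) hz (by omega) fun x hx hxz => ih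
      (mem_erase.2 ⟨hxz.symm, hz⟩) ?_ hc'
    · split_ifs
      exacts [one_pos, hs]
    · rw [card_erase_of_mem hx, hX, hn, hc']
      omega

lemma dotProduct_atlasMat_side (z : β) (X : Finset β) (c : Bool → ℕ) (σ τ : Bool) :
    (fun p : β × Bool => (Pi.single σ 1 : Bool → ℝ) p.2) ⬝ᵥ atlasMat z X c *ᵥ
      (fun p => (Pi.single τ 1 : Bool → ℝ) p.2) =
    posCount z X (c + Pi.single τ 1 + Pi.single σ 1) := by
  rw [← sum_mul_endForm, posCount_add_single, sum_eq_single τ (by intro b _ hb; simp [hb])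
    (by simp), endForm, sum_eq_single σ (by intro b _ hb; simp [hb]) (by simp)]
  simp

/-- Stanley's inequality: the position of an element in a random linear extension has a
log-concave distribution. -/
theorem posCount_mul_le_sq {z : β} {X : Finset β} {c : Bool → ℕ} (hz : z ∈ X)
    (hX : #X = c true + c false + 3) :
    posCount z X (c + Pi.single true 1 + Pi.single true 1) *
      posCount z X (c + Pi.single false 1 + Pi.single false 1) ≤
    posCount z X (c + Pi.single false 1 + Pi.single true 1) ^ 2 := by
  rcases (posCount_nonneg z X (c + Pi.single false 1 + Pi.single false 1)).eq_or_lt with h0 | h0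
  · rw [← h0, mul_zero]
    positivity
  · have := atlasMat_hyperbolic hz hX (fun p => (Pi.single true 1 : Bool → ℝ) p.2)
      (fun p => (Pi.single false 1 : Bool → ℝ) p.2)
    simp only [dotProduct_atlasMat_side] at this
    exact this h0

end LogConcave

section Supermodular
open scoped Classical

variable {β : Type*} [PartialOrder β]

/-- The set `A` is closed under predecessors (`σ = true`) or successors (`σ = false`). -/
def SideClosed (σ : Bool) (A : Finset β) : Prop := ∀ a ∈ A, ∀ b, before σ b a → b ∈ A

lemma SideClosed.erase {σ : Bool} {A : Finset β} (hA : SideClosed σ A) {m : β}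
    (hm : m ∈ ends (!σ) A) : SideClosed σ (A.erase m) := by
  intro a ha b hb
  rw [mem_erase] at ha ⊢
  refine ⟨?_, hA a ha.2 b hb⟩
  rintro rfl
  exact (mem_ends.1 hm).2 a ha.2 (before_not.2 hb)

/-- The number of linear extensions of the subposet `A`. -/
noncomputable def numExt (A : Finset β) : ℝ := #(linLists A)

lemma numExt_pos (A : Finset β) : 0 < numExt A := Nat.cast_pos.2 (card_linLists_pos A)

lemma sum_numExt_erase_le (σ : Bool) {A U : Finset β} (hAU : A ⊆ U) :
    ∑ m ∈ U, (if m ∈ ends σ A then numExt (A.erase m) else 0) ≤ numExt A := by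
  rw [← sum_filter, filter_mem_eq_inter, inter_eq_right.2 fun m hm => hAU (mem_ends.1 hm).1]
  rcases A.eq_empty_or_nonempty with rfl | hA
  · simpa [ends] using (numExt_pos (∅ : Finset β)).le
  · rw [numExt, card_linLists σ A hA, Nat.cast_sum]
    exact le_rfl

lemma sum_numExt_erase (σ : Bool) {A U : Finset β} (hAU : A ⊆ U) (hA : A.Nonempty) :
    ∑ m ∈ U, (if m ∈ ends σ A then numExt (A.erase m) else 0) = numExt A := by
  rw [← sum_filter, filter_mem_eq_inter, inter_eq_right.2 fun m hm => hAU (mem_ends.1 hm).1,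
    numExt, card_linLists σ A hA, Nat.cast_sum]
  rfl

lemma mem_ends_union {σ : Bool} {A B : Finset β} (hB : SideClosed σ B) {m : β}
    (hm : m ∈ ends (!σ) A) (hmB : m ∈ B → m ∈ ends (!σ) B) : m ∈ ends (!σ) (A ∪ B) := by
  rw [mem_ends] at hm ⊢
  refine ⟨mem_union_left _ hm.1, fun y hy hym => ?_⟩
  rcases mem_union.1 hy with hy | hy
  · exact hm.2 y hy hym
  · exact (mem_ends.1 (hmB (hB y hy m (before_not.1 hym)))).2 y hy hym

lemma mem_ends_inter {σ : Bool} {A B : Finset β} {m : β} (hm : m ∈ ends σ A) (hmB : m ∈ B) :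
    m ∈ ends σ (A ∩ B) := by
  rw [mem_ends] at hm ⊢
  exact ⟨mem_inter.2 ⟨hm.1, hmB⟩, fun y hy => hm.2 y (mem_inter.1 hy).1⟩

lemma numExt_erase_mul_le {σ : Bool} {A B : Finset β} (hB : SideClosed σ B) {m : β}
    (hmA : m ∈ ends (!σ) A)
    (h : numExt (A.erase m) * numExt B ≤ numExt (A.erase m ∪ B) * numExt (A.erase m ∩ B))
    (hlt : numExt (A ∪ B) * numExt (A ∩ B) < numExt A * numExt B) :
    numExt (A.erase m) * numExt B * (numExt (A ∪ B) * numExt (A ∩ B)) ≤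
      numExt (A ∪ B) * (if m ∈ ends (!σ) (A ∩ B) then numExt ((A ∩ B).erase m) else 0) *
        (numExt (A ∪ B) * numExt (A ∩ B)) +
      (if m ∈ ends (!σ) (A ∪ B) then numExt ((A ∪ B).erase m) else 0) * numExt (A ∩ B) *
        (numExt A * numExt B) := by
  have hA0 := numExt_pos A
  have hB0 := numExt_pos B
  have hU0 := numExt_pos (A ∪ B)
  have hI0 := numExt_pos (A ∩ B)
  have hm0 := numExt_pos (A.erase m)
  by_cases hm : m ∈ B
  · rw [erase_union_of_mem hm, erase_inter] at h
    rw [if_pos (mem_ends_inter hmA hm)]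
    refine (mul_le_mul_of_nonneg_right h (mul_pos hU0 hI0).le).trans (le_add_of_nonneg_right ?_)
    have := numExt_pos ((A ∪ B).erase m)
    split_ifs <;> positivity
  · rw [erase_inter_comm, erase_eq_of_notMem hm, ← erase_eq_of_notMem hm,
      ← erase_union_distrib, erase_eq_of_notMem hm] at h
    rw [if_pos (mem_ends_union hB hmA fun h => absurd h hm)]
    refine (mul_le_mul h hlt.le (mul_pos hU0 hI0).le ?_).trans (le_add_of_nonneg_left ?_)
    · exact mul_nonneg (numExt_pos _).le hI0.le
    · have := numExt_pos ((A ∩ B).erase m)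
      split_ifs <;> positivity

/-- The number of linear extensions is log-supermodular on the lattice of ideals. -/
theorem numExt_mul_le (σ : Bool) {A B : Finset β} (hA : SideClosed σ A) (hB : SideClosed σ B) :
    numExt A * numExt B ≤ numExt (A ∪ B) * numExt (A ∩ B) := by
  obtain ⟨n, hn⟩ : ∃ n, #A + #B = n := ⟨_, rfl⟩
  induction n using Nat.strong_induction_on generalizing A B with
  | _ n ih =>
  rcases A.eq_empty_or_nonempty with rfl | hAne
  · simp [mul_comm]
  rcases B.eq_empty_or_nonempty with rfl | hBne
  · simp
  by_contra! hlt
  have hY0 : 0 < numExt (A ∪ B) * numExt (A ∩ B) := mul_pos (numExt_pos _) (numExt_pos _)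
  set U := A ∪ B with hU
  set I := A ∩ B with hI
  have ihA : ∀ m ∈ ends (!σ) A, numExt (A.erase m) * numExt B ≤
      numExt (A.erase m ∪ B) * numExt (A.erase m ∩ B) := fun m hm =>
    ih _ (by have := card_erase_lt_of_mem (mem_ends.1 hm).1; omega) (hA.erase hm) hB rfl
  have ihB : ∀ m ∈ ends (!σ) B, numExt A * numExt (B.erase m) ≤
      numExt (A ∪ B.erase m) * numExt (A ∩ B.erase m) := fun m hm =>
    ih _ (by have := card_erase_lt_of_mem (mem_ends.1 hm).1; omega) hA (hB.erase hm) rfl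
  have key : ∀ m ∈ U,
      ((if m ∈ ends (!σ) A then numExt (A.erase m) else 0) * numExt B +
        numExt A * (if m ∈ ends (!σ) B then numExt (B.erase m) else 0)) *
        (numExt U * numExt I) ≤
      numExt U * (if m ∈ ends (!σ) I then numExt (I.erase m) else 0) * (numExt U * numExt I) +
        (if m ∈ ends (!σ) U then numExt (U.erase m) else 0) * numExt I *
          (numExt A * numExt B) := by
    intro m hm
    have hs0 : 0 ≤ numExt U * (if m ∈ ends (!σ) I then numExt (I.erase m) else 0) *
        (numExt U * numExt I) :=
      mul_nonneg (mul_nonneg (numExt_pos _).le (by split_ifs; exacts [(numExt_pos _).le, le_rfl]))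
        hY0.le
    have hr0 : 0 ≤ (if m ∈ ends (!σ) U then numExt (U.erase m) else 0) * numExt I :=
      mul_nonneg (by split_ifs; exacts [(numExt_pos _).le, le_rfl]) (numExt_pos _).le
    have hr1 := mul_nonneg hr0 (mul_pos (numExt_pos A) (numExt_pos B)).le
    by_cases hmA : m ∈ ends (!σ) A <;> by_cases hmB : m ∈ ends (!σ) B
    · have hmI := mem_ends_inter hmA (mem_ends.1 hmB).1
      have hmU := mem_ends_union hB hmA fun _ => hmB
      have h1 := ihA m hmA
      have h2 := ihB m hmB
      have h3 := ih _ (by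
        have := card_erase_lt_of_mem (mem_ends.1 hmA).1
        have := card_erase_le (s := B) (a := m)
        omega) (hA.erase hmA) (hB.erase hmB) rfl
      rw [erase_union_of_mem (mem_ends.1 hmB).1, erase_inter] at h1
      rw [union_erase_of_mem (mem_ends.1 hmA).1, inter_erase] at h2
      rw [← erase_union_distrib, erase_inter, inter_erase, erase_idem] at h3
      rw [if_pos hmA, if_pos hmB, if_pos hmI, if_pos hmU]
      refine le_of_mul_le_mul_left ?_ (mul_pos (numExt_pos U) (numExt_pos (I.erase m)))
      have h4 := mul_nonneg (mul_nonneg (sub_nonneg.2 h1) (sub_nonneg.2 h2)) hY0.le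
      have h5 := mul_le_mul_of_nonneg_left h3
        (mul_pos (mul_pos (numExt_pos A) (numExt_pos B)) hY0).le
      nlinarith
    · rw [if_pos hmA, if_neg hmB, mul_zero, add_zero]
      exact numExt_erase_mul_le hB hmA (ihA m hmA) hlt
    · have h1 := ihB m hmB
      rw [mul_comm, union_comm, inter_comm] at h1
      rw [mul_comm (numExt A)] at hlt
      rw [hU, hI, union_comm, inter_comm] at hlt ⊢
      rw [if_neg hmA, if_pos hmB, zero_mul, zero_add, mul_comm (numExt A), mul_comm (numExt A)]
      exact numExt_erase_mul_le hA hmB h1 hlt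
    · simpa [hmA, hmB] using add_nonneg hs0 hr1
  have hsum := sum_le_sum key
  have h1 := sum_numExt_erase (!σ) (subset_union_left : A ⊆ U) hAne
  have h2 := sum_numExt_erase (!σ) (subset_union_right : B ⊆ U) hBne
  have h3 := sum_numExt_erase_le (!σ) (Subset.refl U)
  have h4 := sum_numExt_erase_le (!σ) (inter_subset_union : I ⊆ U)
  rw [← sum_mul, sum_add_distrib, sum_add_distrib, ← sum_mul, ← mul_sum, ← sum_mul, ← sum_mul,
    ← mul_sum, ← sum_mul, h1, h2] at hsum
  have h3' := mul_le_mul_of_nonneg_right (mul_le_mul_of_nonneg_right h3 (numExt_pos I).le)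
    (mul_pos (numExt_pos A) (numExt_pos B)).le
  have h4' := mul_le_mul_of_nonneg_right (mul_le_mul_of_nonneg_left h4 (numExt_pos U).le) hY0.le
  nlinarith

end Supermodular

section Correlation
open scoped Classical

/-- The FKG lattice condition for weights on finite sets. -/
def LogSupermodular {β : Type*} (μ : Finset β → ℝ) : Prop :=
  ∀ I J, μ I * μ J ≤ μ (I ∩ J) * μ (I ∪ J)

lemma LogSupermodular.restrict {β : Type*} {μ : Finset β → ℝ} (hμ : LogSupermodular μ)
    (hμ0 : ∀ I, 0 ≤ μ I) {p : Finset β → Prop} [DecidablePred p] (hi : ∀ I J, p I → p J → p (I ∩ J))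
    (hu : ∀ I J, p I → p J → p (I ∪ J)) : LogSupermodular fun I => if p I then μ I else 0 := by
  intro I J
  by_cases hI : p I
  · by_cases hJ : p J
    · simpa only [hI, hJ, hi I J hI hJ, hu I J hI hJ, if_true] using hμ I J
    · simp only [hJ, if_false, mul_zero]
      exact mul_nonneg (by split_ifs; exacts [hμ0 _, le_rfl]) (by split_ifs; exacts [hμ0 _, le_rfl])
  · simp only [hI, if_false, zero_mul]
    exact mul_nonneg (by split_ifs; exacts [hμ0 _, le_rfl]) (by split_ifs; exacts [hμ0 _, le_rfl])

variable {β : Type*} [Fintype β]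

lemma pow_card_mul_le_sum_of_subset {μ : Finset β → ℝ} (hμ0 : ∀ I, 0 ≤ μ I)
    (hμ : LogSupermodular μ) {q : ℝ} (hq : 0 ≤ q) (A : Finset β)
    (hA : ∀ a ∈ A, q * ∑ I, μ I ≤ ∑ I, if a ∈ I then μ I else 0) :
    q ^ #A * ∑ I, μ I ≤ ∑ I, if A ⊆ I then μ I else 0 := by
  induction A using Finset.induction_on with
  | empty => simp
  | insert a A ha ih =>
    have ih := ih fun b hb => hA b (mem_insert_of_mem hb)
    have h1 := hA a (mem_insert_self a A)
    have hfkg := fkg (μ := μ) (f := fun I => if A ⊆ I then 1 else 0)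
      (g := fun I => if a ∈ I then 1 else 0) hμ0 (fun I => by positivity)
      (fun I => by positivity) (fun I J h => by
        dsimp only
        split_ifs with h1 h2
        exacts [le_rfl, absurd (h1.trans h) h2, zero_le_one, le_rfl]) (fun I J h => by
        dsimp only
        split_ifs with h1 h2
        exacts [le_rfl, absurd (h h1) h2, zero_le_one, le_rfl]) hμ
    have hZ : 0 ≤ ∑ I, μ I := sum_nonneg fun I _ => hμ0 I
    rcases hZ.eq_or_lt with hZ | hZ
    · rw [← hZ, mul_zero]
      exact sum_nonneg fun I _ => by split_ifs; exacts [hμ0 I, le_rfl]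
    · refine le_of_mul_le_mul_left ?_ hZ
      rw [card_insert_of_notMem ha]
      simp only [mul_ite, mul_one, mul_zero, ← ite_and] at hfkg
      have h2 := mul_le_mul ih h1 (mul_nonneg hq hZ.le)
        (sum_nonneg fun I _ => by split_ifs; exacts [hμ0 I, le_rfl])
      have h3 : (∑ I, if insert a A ⊆ I then μ I else 0) =
          ∑ I, if a ∈ I ∧ A ⊆ I then μ I else 0 :=
        sum_congr rfl fun I _ => if_congr insert_subset_iff rfl rfl
      rw [h3]
      calc _ = (q ^ #A * ∑ I, μ I) * (q * ∑ I, μ I) := by ring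
        _ ≤ _ := h2.trans hfkg

lemma pow_card_mul_le_sum_of_disjoint {μ : Finset β → ℝ} (hμ0 : ∀ I, 0 ≤ μ I)
    (hμ : LogSupermodular μ) {q : ℝ} (hq : 0 ≤ q) (A : Finset β)
    (hA : ∀ a ∈ A, q * ∑ I, μ I ≤ ∑ I, if a ∉ I then μ I else 0) :
    q ^ #A * ∑ I, μ I ≤ ∑ I, if ∀ a ∈ A, a ∉ I then μ I else 0 := by
  have hcompl : ∀ f : Finset β → ℝ, ∑ I, f Iᶜ = ∑ I, f I :=
    fun f => Equiv.sum_comp (compl_involutive (α := Finset β)).toPerm f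
  have h := pow_card_mul_le_sum_of_subset (μ := fun I => μ Iᶜ) (fun I => hμ0 _) (fun I J => by
    have := hμ Iᶜ Jᶜ
    simp only [compl_inter, compl_union]
    linarith) hq A (fun a ha => by
      rw [hcompl μ]
      refine (hA a ha).trans_eq ?_
      rw [← hcompl]
      simp)
  rw [hcompl μ] at h
  refine h.trans_eq ?_
  rw [← hcompl]
  simp [subset_iff]

/-- If a log-supermodular weight makes every pair of events `d ∈ I`, `u ∉ I` likely, then all of
them hold simultaneously with probability bounded below. -/
lemma le_sum_of_subset_of_disjoint {μ : Finset β → ℝ} (hμ0 : ∀ I, 0 ≤ μ I)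
    (hμ : LogSupermodular μ) {η : ℝ} (hη0 : 0 ≤ η) (hη : η ≤ 1 / 2) {w : ℕ} {D U : Finset β}
    (hDw : #D ≤ w) (hUw : #U ≤ w)
    (hD : ∀ d ∈ D, (1 / 2 + η) * ∑ I, μ I ≤ ∑ I, if d ∈ I then μ I else 0)
    (hU : ∀ u ∈ U, (1 / 2 + η) * ∑ I, μ I ≤ ∑ I, if u ∉ I then μ I else 0) :
    ((2 * η) ^ w / 2) ^ w * (2 * η) ^ w * ∑ I, μ I ≤
      ∑ I, if D ⊆ I ∧ ∀ u ∈ U, u ∉ I then μ I else 0 := by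
  have hZ : 0 ≤ ∑ I, μ I := sum_nonneg fun I _ => hμ0 I
  have h2η0 : 0 ≤ 2 * η := by linarith
  have h2η1 : 2 * η ≤ 1 := by linarith
  set q := (2 * η) ^ w / 2 with hq
  have hq0 : 0 ≤ q := by positivity
  have hq1 : q ≤ 1 := by have := pow_le_one₀ (n := w) h2η0 h2η1; linarith
  have hZD : (2 * η) ^ w * ∑ I, μ I ≤ ∑ I, if D ⊆ I then μ I else 0 := by
    refine le_trans (mul_le_mul_of_nonneg_right (pow_le_pow_of_le_one h2η0 h2η1 hDw) hZ)
      (pow_card_mul_le_sum_of_subset hμ0 hμ h2η0 D fun d hd => le_trans ?_ (hD d hd))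
    exact mul_le_mul_of_nonneg_right (by linarith) hZ
  have hDZ : (∑ I, if D ⊆ I then μ I else 0) ≤ ∑ I, μ I :=
    sum_le_sum fun I _ => by split_ifs; exacts [le_rfl, hμ0 I]
  have hDu : ∀ u ∈ U, q * ∑ I, μ I ≤ ∑ I, if u ∉ I then (if D ⊆ I then μ I else 0) else 0 := by
    intro u hu
    have hZu : (∑ I, if u ∉ I then μ I else 0) ≤ ∑ I, μ I :=
      sum_le_sum fun I _ => by split_ifs; exacts [hμ0 I, le_rfl]
    have h := pow_card_mul_le_sum_of_subset (μ := fun I => if u ∉ I then μ I else 0)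
      (fun I => by split_ifs; exacts [le_rfl, hμ0 I])
      (hμ.restrict hμ0 (fun I J h _ h' => h (mem_inter.1 h').1) fun I J h h' h'' =>
        (mem_union.1 h'').elim h h') h2η0 D (fun d hd => by
          have h1 : ∑ I, (if d ∈ I then μ I else 0) + ∑ I, (if u ∉ I then μ I else 0) ≤
              ∑ I, μ I + ∑ I, if d ∈ I then (if u ∉ I then μ I else 0) else 0 := by
            rw [← sum_add_distrib, ← sum_add_distrib]
            refine sum_le_sum fun I _ => ?_
            have := hμ0 I
            split_ifs <;> linarith
          have h2 := hD d hd
          have h3 := hU u hu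
          have h4 := mul_le_mul_of_nonneg_left hZu h2η0
          linarith)
    have h1 : (∑ I, if u ∉ I then (if D ⊆ I then μ I else 0) else 0) =
        ∑ I, if D ⊆ I then (if u ∉ I then μ I else 0) else 0 :=
      sum_congr rfl fun I _ => by split_ifs <;> rfl
    rw [h1]
    refine le_trans ?_ h
    have h2 : 1 / 2 * ∑ I, μ I ≤ ∑ I, if u ∉ I then μ I else 0 :=
      le_trans (mul_le_mul_of_nonneg_right (by linarith) hZ) (hU u hu)
    calc q * ∑ I, μ I = (2 * η) ^ w * (1 / 2 * ∑ I, μ I) := by rw [hq]; ring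
      _ ≤ (2 * η) ^ #D * ∑ I, if u ∉ I then μ I else 0 :=
        mul_le_mul (pow_le_pow_of_le_one h2η0 h2η1 hDw) h2 (by positivity) (by positivity)
  have h := pow_card_mul_le_sum_of_disjoint (μ := fun I => if D ⊆ I then μ I else 0)
    (fun I => by split_ifs; exacts [hμ0 I, le_rfl])
    (hμ.restrict hμ0 (fun I J => subset_inter) fun I J (h : D ⊆ I) _ =>
      h.trans subset_union_left) hq0 U
    (fun u hu => le_trans (mul_le_mul_of_nonneg_left hDZ hq0) (hDu u hu))
  calc q ^ w * (2 * η) ^ w * ∑ I, μ I = q ^ w * ((2 * η) ^ w * ∑ I, μ I) := by ring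
    _ ≤ q ^ #U * ∑ I, if D ⊆ I then μ I else 0 :=
      mul_le_mul (pow_le_pow_of_le_one hq0 hq1 hUw) hZD (by positivity) (by positivity)
    _ ≤ _ := h
    _ = _ := sum_congr rfl fun I _ => by
      simp only [← ite_and, and_comm]

end Correlation

section Below
open scoped Classical

variable {β : Type*}

/-- The set of elements preceding `x` in the list `l`. -/
noncomputable def below [Fintype β] (x : β) (l : List β) : Finset β :=
  {y | l.idxOf y < l.idxOf x}

lemma mem_below [Fintype β] {x y : β} {l : List β} : y ∈ below x l ↔ l.idxOf y < l.idxOf x := by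
  simp [below]

lemma below_append [Fintype β] {x : β} {l l' : List β} (hx : x ∉ l) {I : Finset β}
    (hI : ∀ y, y ∈ l ↔ y ∈ I) : below x (l ++ x :: l') = I := by
  ext y
  rw [mem_below, List.idxOf_append_of_notMem hx, List.idxOf_cons_self, ← hI, add_zero]
  by_cases hy : y ∈ l
  · simpa [hy, List.idxOf_append_of_mem hy] using List.idxOf_lt_length_iff.2 hy
  · simp [hy, List.idxOf_append_of_notMem hy]

variable [PartialOrder β]

/-- `I` is the set of elements preceding `x` in some linear extension. -/
def IsBelow (x : β) (I : Finset β) : Prop :=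
  SideClosed true I ∧ (∀ b, b < x → b ∈ I) ∧ x ∉ I

lemma IsBelow.inter {x : β} {I J : Finset β} (hI : IsBelow x I) (hJ : IsBelow x J) :
    IsBelow x (I ∩ J) := by
  refine ⟨fun a ha b hb => ?_, fun b hb => mem_inter.2 ⟨hI.2.1 b hb, hJ.2.1 b hb⟩,
    fun h => hI.2.2 (mem_inter.1 h).1⟩
  rw [mem_inter] at ha ⊢
  exact ⟨hI.1 a ha.1 b hb, hJ.1 a ha.2 b hb⟩

lemma IsBelow.union {x : β} {I J : Finset β} (hI : IsBelow x I) (hJ : IsBelow x J) :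
    IsBelow x (I ∪ J) := by
  refine ⟨fun a ha b hb => ?_, fun b hb => mem_union_left _ (hI.2.1 b hb),
    fun h => (mem_union.1 h).elim hI.2.2 hJ.2.2⟩
  rw [mem_union] at ha ⊢
  exact ha.imp (fun h => hI.1 a h b hb) fun h => hJ.1 a h b hb

variable [Fintype β]

lemma mem_of_mem_linLists_univ {l : List β} (hl : l ∈ linLists univ) (y : β) : y ∈ l :=
  ((mem_linLists.1 hl).2.1 y).2 (mem_univ y)

lemma idxOf_lt_idxOf {l : List β} (hl : l ∈ linLists univ) {a b : β} (hab : b < a) :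
    l.idxOf b < l.idxOf a := by
  have ha := List.idxOf_lt_length_iff.2 (mem_of_mem_linLists_univ hl a)
  have hb := List.idxOf_lt_length_iff.2 (mem_of_mem_linLists_univ hl b)
  by_contra! hle
  rcases hle.eq_or_lt with h | h
  · exact hab.ne' ((List.idxOf_inj (mem_of_mem_linLists_univ hl a)).1 h)
  · have := List.pairwise_iff_getElem.1 (mem_linLists.1 hl).2.2 _ _ ha hb h
    rw [List.getElem_idxOf, List.getElem_idxOf] at this
    exact this hab

/-- The number of linear extensions in which the set of elements preceding `x` is `I`. -/
noncomputable def belowWeight (x : β) (I : Finset β) : ℝ :=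
  if IsBelow x I then numExt I * numExt (insert x I)ᶜ else 0

lemma belowWeight_nonneg (x : β) (I : Finset β) : 0 ≤ belowWeight x I := by
  rw [belowWeight]
  split_ifs
  exacts [mul_nonneg (numExt_pos _).le (numExt_pos _).le, le_rfl]

lemma IsBelow.sideClosed_compl {x : β} {I : Finset β} (hI : IsBelow x I) :
    SideClosed false (insert x I)ᶜ := by
  intro a ha b (hb : a < b)
  rw [mem_compl] at ha ⊢
  refine fun h => ha (mem_insert_of_mem ?_)
  rcases mem_insert.1 h with rfl | h
  · exact hI.2.1 a hb
  · exact hI.1 b h a hb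

lemma belowWeight_logSupermodular (x : β) : LogSupermodular (belowWeight x) := by
  intro I J
  by_cases hIJ : IsBelow x I ∧ IsBelow x J
  · obtain ⟨hI, hJ⟩ := hIJ
    have h1 := numExt_mul_le true hI.1 hJ.1
    have h2 := numExt_mul_le false hI.sideClosed_compl hJ.sideClosed_compl
    rw [← compl_inter, ← compl_union, ← insert_inter_distrib, ← insert_union_distrib] at h2
    rw [belowWeight, belowWeight, belowWeight, belowWeight, if_pos hI, if_pos hJ,
      if_pos (hI.inter hJ), if_pos (hI.union hJ)]
    calc _ = (numExt I * numExt J) * (numExt (insert x I)ᶜ * numExt (insert x J)ᶜ) := by ring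
      _ ≤ _ := mul_le_mul h1 h2 (mul_nonneg (numExt_pos _).le (numExt_pos _).le)
        (mul_nonneg (numExt_pos _).le (numExt_pos _).le)
      _ = _ := by ring
  · have h0 : belowWeight x I * belowWeight x J = 0 := by
      rw [mul_eq_zero, belowWeight, belowWeight]
      by_cases hI : IsBelow x I
      · exact Or.inr (if_neg fun hJ => hIJ ⟨hI, hJ⟩)
      · exact Or.inl (if_neg hI)
    rw [h0]
    exact mul_nonneg (belowWeight_nonneg _ _) (belowWeight_nonneg _ _)

lemma isBelow_below {x : β} {l : List β} (hl : l ∈ linLists univ) : IsBelow x (below x l) := by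
  refine ⟨fun a ha b hb => ?_, fun b hb => mem_below.2 (idxOf_lt_idxOf hl hb), fun h => ?_⟩
  · exact mem_below.2 ((idxOf_lt_idxOf hl hb).trans (mem_below.1 ha))
  · exact lt_irrefl _ (mem_below.1 h)

lemma append_mem_linLists_univ {x : β} {I : Finset β} (hI : IsBelow x I) {l l' : List β} :
    l ++ x :: l' ∈ linLists univ ∧ (∀ y, y ∈ l ↔ y ∈ I) ↔
      l ∈ linLists I ∧ l' ∈ linLists (insert x I)ᶜ := by
  simp only [mem_linLists, List.nodup_append, List.nodup_cons, List.pairwise_append,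
    List.pairwise_cons, List.mem_append, List.mem_cons, mem_univ, iff_true, mem_compl, mem_insert,
    not_or]
  constructor
  · rintro ⟨⟨⟨h1, ⟨h2, h3⟩, h4⟩, h5, h6, ⟨h7, h8⟩, h9⟩, h10⟩
    refine ⟨⟨h1, h10, h6⟩, h3, fun y => ⟨fun hy => ⟨?_, fun hyI => ?_⟩, fun hy => ?_⟩, h8⟩
    · rintro rfl
      exact h2 hy
    · exact h4 y ((h10 y).2 hyI) y (Or.inr hy) rfl
    · exact ((h5 y).resolve_left fun h => hy.2 ((h10 y).1 h)).resolve_left hy.1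
  · rintro ⟨⟨h1, h2, h3⟩, h4, h5, h6⟩
    refine ⟨⟨⟨h1, ⟨fun h => ((h5 x).1 h).1 rfl, h4⟩, fun a ha b hb => ?_⟩, fun y => ?_, h3,
      ⟨fun a ha hax => ((h5 a).1 ha).2 (hI.2.1 a hax), h6⟩, fun a ha b hb hba => ?_⟩, h2⟩
    · rintro rfl
      rcases hb with rfl | hb
      · exact hI.2.2 ((h2 _).1 ha)
      · exact ((h5 _).1 hb).2 ((h2 _).1 ha)
    · rw [h2, h5]
      tauto
    · have hbI := hI.1 a ((h2 a).1 ha) b hba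
      rcases hb with rfl | hb
      · exact hI.2.2 hbI
      · exact ((h5 _).1 hb).2 hbI

lemma card_filter_below (x : β) (I : Finset β) :
    (#{l ∈ linLists univ | below x l = I} : ℝ) = belowWeight x I := by
  rw [belowWeight]
  split_ifs with hI
  · rw [numExt, numExt, ← Nat.cast_mul, ← card_product, Nat.cast_inj]
    symm
    refine card_bij (fun p _ => p.1 ++ x :: p.2) (fun p hp => ?_) (fun p hp q hq h => ?_)
      fun l hl => ?_
    · have := (append_mem_linLists_univ hI).2 (mem_product.1 hp)
      exact mem_filter.2 ⟨this.1, below_append (fun h => hI.2.2 ((this.2 x).1 h)) this.2⟩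
    · have hp := (append_mem_linLists_univ hI).2 (mem_product.1 hp)
      have hq := (append_mem_linLists_univ hI).2 (mem_product.1 hq)
      have hlen : p.1.length = q.1.length := by
        have := congrArg (List.idxOf x) h
        rwa [List.idxOf_append_of_notMem fun h => hI.2.2 ((hp.2 x).1 h),
          List.idxOf_append_of_notMem fun h => hI.2.2 ((hq.2 x).1 h), List.idxOf_cons_self,
          List.idxOf_cons_self] at this
      obtain ⟨h1, h2⟩ := List.append_inj h hlen
      exact Prod.ext h1 (List.cons.inj h2).2
    · obtain ⟨hl, hlI⟩ := mem_filter.1 hl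
      obtain ⟨s, t, rfl⟩ := List.mem_iff_append.1 (mem_of_mem_linLists_univ hl x)
      have hxs : x ∉ s := by
        have := (mem_linLists.1 hl).1
        rw [List.nodup_append] at this
        exact fun h => this.2.2 x h x (List.mem_cons_self) rfl
      have hs : ∀ y, y ∈ s ↔ y ∈ I := fun y => by
        rw [← hlI, below_append (I := s.toFinset) hxs fun y => List.mem_toFinset.symm,
          List.mem_toFinset]
      exact ⟨(s, t), mem_product.2 ((append_mem_linLists_univ hI).1 ⟨hl, hs⟩), rfl⟩
  · rw [Nat.cast_eq_zero, card_eq_zero, filter_eq_empty_iff]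
    rintro l hl rfl
    exact hI (isBelow_below hl)

lemma sum_belowWeight (x : β) (p : Finset β → Prop) [DecidablePred p] :
    (∑ I, if p I then belowWeight x I else 0) = #{l ∈ linLists univ | p (below x l)} := by
  rw [card_eq_sum_card_fiberwise (f := below x) (t := univ) (by simp), Nat.cast_sum]
  refine sum_congr rfl fun I _ => ?_
  rw [filter_filter]
  split_ifs with h
  · rw [← card_filter_below]
    congr 2
    refine filter_congr fun l _ => ⟨fun h' => ⟨h' ▸ h, h'⟩, fun h' => h'.2⟩
  · rw [filter_false_of_mem]
    · simp
    · rintro l - ⟨h1, h2⟩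
      exact h (h2 ▸ h1)

lemma sum_belowWeight_univ (x : β) : ∑ I, belowWeight x I = numExt (univ : Finset β) := by
  simpa [numExt] using sum_belowWeight x fun _ => True

end Below

section LinExtList
open scoped Classical

variable {β : Type*} [PartialOrder β] [Fintype β]

/-- The elements of the poset listed in the order of the linear extension `f`. -/
def LinExt.toList (f : LinExt β) : List β := List.ofFn f.1.symm

lemma LinExt.idxOf_toList (f : LinExt β) (y : β) : f.toList.idxOf y = f.1 y := by
  have hnd : f.toList.Nodup := List.nodup_ofFn.2 f.1.symm.injective
  have h := hnd.idxOf_getElem (f.1 y) (by simp [LinExt.toList])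
  simpa [LinExt.toList] using h

lemma LinExt.val_eq (f : LinExt β) (y : β) : _root_.val f y = f.toList.idxOf y + 1 := by
  rw [f.idxOf_toList]
  rfl

lemma LinExt.toList_mem (f : LinExt β) : f.toList ∈ linLists univ := by
  refine mem_linLists.2 ⟨List.nodup_ofFn.2 f.1.symm.injective, fun y => ?_, ?_⟩
  · simp only [LinExt.toList, List.mem_ofFn, mem_univ, iff_true]
    exact ⟨f.1 y, f.1.symm_apply_apply y⟩
  · rw [LinExt.toList, List.pairwise_ofFn]
    intro i j hij hlt
    have := f.2 _ _ hlt
    rw [Equiv.apply_symm_apply, Equiv.apply_symm_apply] at this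
    exact this.not_gt hij

lemma LinExt.toList_injective : Function.Injective (LinExt.toList (β := β)) := by
  intro f g h
  refine Subtype.ext (Equiv.ext fun y => Fin.ext ?_)
  rw [← f.idxOf_toList, ← g.idxOf_toList, h]

lemma LinExt.exists_toList_eq {l : List β} (hl : l ∈ linLists univ) :
    ∃ f : LinExt β, f.toList = l := by
  have hlen := length_of_mem_linLists hl
  rw [card_univ] at hlen
  let e : Fin l.length ≃ β := (mem_linLists.1 hl).1.getEquivOfForallMemList l
    (mem_of_mem_linLists_univ hl)
  refine ⟨⟨e.symm.trans (finCongr hlen), fun a b hab => ?_⟩, ?_⟩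
  · exact idxOf_lt_idxOf hl hab
  · refine List.ext_getElem (by simp [LinExt.toList, hlen]) fun i h1 h2 => ?_
    simp [LinExt.toList, e]

lemma card_linExt (p : LinExt β → Prop) (q : List β → Prop) (h : ∀ f, p f ↔ q f.toList) :
    Nat.card {f : LinExt β // p f} = #{l ∈ linLists univ | q l} := by
  rw [Nat.card_eq_fintype_card, Fintype.card_subtype]
  refine card_bij (fun f _ => f.toList) (fun f hf => ?_) (fun f _ g _ h => f.toList_injective h)
    fun l hl => ?_
  · exact mem_filter.2 ⟨f.toList_mem, (h f).1 (mem_filter.1 hf).2⟩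
  · obtain ⟨hl, hq⟩ := mem_filter.1 hl
    obtain ⟨f, rfl⟩ := LinExt.exists_toList_eq hl
    exact ⟨f, mem_filter.2 ⟨mem_univ _, (h f).2 hq⟩, rfl⟩

lemma card_linExt_univ : (Nat.card (LinExt β) : ℝ) = numExt (univ : Finset β) := by
  have h := card_linExt (β := β) (fun _ => True) (fun _ => True) fun _ => Iff.rfl
  rw [filter_true] at h
  rw [numExt, ← h, Nat.card_congr (Equiv.subtypeUnivEquiv fun _ => trivial)]

lemma prLT_eq (x y : β) :
    prLT x y = #{l ∈ linLists univ | x ∈ below y l} / numExt (univ : Finset β) := by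
  have h := card_linExt (fun f : LinExt β => _root_.val f x < _root_.val f y)
    (fun l => x ∈ below y l)
    fun f => by rw [mem_below, f.val_eq, f.val_eq, Nat.add_lt_add_iff_right]
  rw [prLT, Pr, card_linExt_univ, h]
  congr!

lemma sum_mem_belowWeight (x d : β) :
    (∑ I, if d ∈ I then belowWeight x I else 0) = prLT d x * numExt (univ : Finset β) := by
  rw [sum_belowWeight, prLT_eq, div_mul_cancel₀ _ (numExt_pos _).ne']

lemma sum_notMem_belowWeight {x u : β} (hxu : u ≠ x) :
    (∑ I, if u ∉ I then belowWeight x I else 0) = prLT x u * numExt (univ : Finset β) := by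
  rw [sum_belowWeight, prLT_eq, div_mul_cancel₀ _ (numExt_pos _).ne']
  congr 2
  refine filter_congr fun l hl => ?_
  rw [mem_below, mem_below, not_lt, le_iff_lt_or_eq, or_iff_left]
  exact fun h => hxu ((List.idxOf_inj (mem_of_mem_linLists_univ hl x)).1 h).symm

lemma prLT_add_prLT {x y : β} (hxy : y ≠ x) : prLT x y + prLT y x = 1 := by
  have h := sum_belowWeight_univ x
  rw [← sum_congr rfl fun I _ => (show (if y ∉ I then belowWeight x I else 0) +
    (if y ∈ I then belowWeight x I else 0) = belowWeight x I by split_ifs <;> simp_all),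
    sum_add_distrib, sum_notMem_belowWeight hxy, sum_mem_belowWeight, ← add_mul] at h
  exact mul_right_cancel₀ (numExt_pos _).ne' (h.trans (one_mul _).symm)

end LinExtList

section LogConcaveTail

/-- A nonnegative log-concave sequence without internal zeros. -/
structure LogConcaveSeq (p : ℕ → ℝ) : Prop where
  nonneg : ∀ i, 0 ≤ p i
  mul_le_sq : ∀ i, p i * p (i + 2) ≤ p (i + 1) ^ 2
  pos : ∀ i j k, i ≤ j → j ≤ k → 0 < p i → 0 < p k → 0 < p j

lemma LogConcaveSeq.mul_le_mul {p : ℕ → ℝ} (hp : LogConcaveSeq p) {l m : ℕ} (hlm : l ≤ m) :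
    p l * p (m + 1) ≤ p (l + 1) * p m := by
  induction m, hlm using Nat.le_induction with
  | base => exact (mul_comm _ _).le
  | succ m hlm ih =>
    have hr := mul_nonneg (hp.nonneg (l + 1)) (hp.nonneg (m + 1))
    rcases (hp.nonneg l).eq_or_lt with h0 | h0
    · rwa [← h0, zero_mul]
    rcases (hp.nonneg (m + 1 + 1)).eq_or_lt with h2 | h2
    · rwa [← h2, mul_zero]
    have hm := hp.pos l m (m + 2) hlm (by omega) h0 h2
    refine le_of_mul_le_mul_right ?_ hm
    calc p l * p (m + 1 + 1) * p m = p l * (p m * p (m + 2)) := by ring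
      _ ≤ p l * p (m + 1) ^ 2 := mul_le_mul_of_nonneg_left (hp.mul_le_sq m) h0.le
      _ = p l * p (m + 1) * p (m + 1) := by ring
      _ ≤ p (l + 1) * p m * p (m + 1) := mul_le_mul_of_nonneg_right ih (hp.nonneg _)
      _ = p (l + 1) * p (m + 1) * p m := by ring

lemma LogConcaveSeq.shift {p : ℕ → ℝ} (hp : LogConcaveSeq p) (k : ℕ) :
    LogConcaveSeq fun i => p (k + i) :=
  ⟨fun _ => hp.nonneg _, fun _ => hp.mul_le_sq _, fun _ _ _ hij hjk =>
    hp.pos _ _ _ (by omega) (by omega)⟩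

lemma LogConcaveSeq.reflect {p : ℕ → ℝ} (hp : LogConcaveSeq p) (k : ℕ) :
    LogConcaveSeq fun i => if i ≤ k then p (k - i) else 0 := by
  refine ⟨fun i => ?_, fun i => ?_, fun i j l hij hjl hi hl => ?_⟩
  · split_ifs
    exacts [hp.nonneg _, le_rfl]
  · by_cases h : i + 2 ≤ k
    · obtain ⟨m, rfl⟩ := Nat.exists_eq_add_of_le h
      have := hp.mul_le_sq m
      simp only [show i ≤ i + 2 + m by omega, show i + 1 ≤ i + 2 + m by omega, h, if_true,
        show i + 2 + m - i = m + 2 by omega, show i + 2 + m - (i + 1) = m + 1 by omega,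
        show i + 2 + m - (i + 2) = m by omega]
      linarith
    · simp only [if_neg h, mul_zero]
      positivity
  · by_cases h : l ≤ k
    · simp only [h, show i ≤ k by omega, show j ≤ k by omega, if_true] at hi hl ⊢
      exact hp.pos _ _ _ (by omega) (by omega) hl hi
    · simp only [if_neg h, lt_self_iff_false] at hl

/-- A sequence of total mass at most one which is at least `c` at the origin drops by a definite
factor within its first few steps. -/
lemma exists_le_mul_of_sum_le_one {p : ℕ → ℝ} (hsum : ∀ N, ∑ i ∈ range N, p i ≤ 1) {c : ℝ}
    (hc : 0 < c) (hc0 : c ≤ p 0) {L : ℕ}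
    (hL : 2 / c ≤ L) : ∃ j < L, 0 < p j ∧ p (j + 1) ≤ (1 - 1 / (2 * L)) * p j := by
  have hL0 : (0 : ℝ) < L := (div_pos two_pos hc).trans_le hL
  have hL1 : (1 : ℝ) ≤ L := Nat.one_le_cast.2 (Nat.cast_pos.1 hL0)
  set ρ : ℝ := 1 - 1 / (2 * L) with hρ
  have hhalf : 1 / (2 * (L : ℝ)) ≤ 1 / 2 := by
    rw [div_le_div_iff₀ (by positivity) two_pos]
    linarith
  have hpos : 0 < 1 / (2 * (L : ℝ)) := by positivity
  have hρ0 : 0 < ρ := by linarith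
  have hρ1 : ρ ≤ 1 := by linarith
  by_contra! hcon
  have key : ∀ j ≤ L, ρ ^ j * c ≤ p j := by
    intro j hj
    induction j with
    | zero => simpa using hc0
    | succ j ih =>
      have ih := ih (by omega)
      have := hcon j (by omega) ((by positivity : 0 < ρ ^ j * c).trans_le ih)
      calc ρ ^ (j + 1) * c = ρ * (ρ ^ j * c) := by ring
        _ ≤ ρ * p j := mul_le_mul_of_nonneg_left ih hρ0.le
        _ ≤ p (j + 1) := this.le
  have hbern : (1 : ℝ) / 2 ≤ ρ ^ L := by
    have h := one_add_mul_le_pow (a := -(1 / (2 * (L : ℝ)))) (by linarith) L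
    have : 1 + (L : ℝ) * -(1 / (2 * (L : ℝ))) = 1 / 2 := by
      field_simp
      norm_num
    rw [this] at h
    rwa [hρ, sub_eq_add_neg]
  have hlow : ∑ _i ∈ range (L + 1), c / 2 ≤ ∑ i ∈ range (L + 1), p i := by
    refine sum_le_sum fun i hi => ?_
    have hi : i ≤ L := Nat.lt_succ_iff.1 (mem_range.1 hi)
    have h1 := pow_le_pow_of_le_one hρ0.le hρ1 hi
    have h2 := mul_le_mul_of_nonneg_right (hbern.trans h1) hc.le
    linarith [key i hi]
  rw [sum_const, card_range, nsmul_eq_mul, Nat.cast_add, Nat.cast_one] at hlow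
  have h1 := hsum (L + 1)
  rw [div_le_iff₀ hc] at hL
  nlinarith

/-- The second moment of a log-concave sequence of total mass at most one is bounded in terms of
its value at the origin. -/
lemma exists_sum_sq_mul_le {c : ℝ} (hc : 0 < c) :
    ∃ C : ℝ, ∀ p : ℕ → ℝ, LogConcaveSeq p → (∀ N, ∑ i ∈ range N, p i ≤ 1) → c ≤ p 0 →
      ∀ N, ∑ i ∈ range N, (i : ℝ) ^ 2 * p i ≤ C := by
  obtain ⟨L, hL⟩ := exists_nat_ge (2 / c)
  have hL0 : (0 : ℝ) < L := (div_pos two_pos hc).trans_le hL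
  have hL1 : (1 : ℝ) ≤ L := Nat.one_le_cast.2 (Nat.cast_pos.1 hL0)
  obtain ⟨ρ, hρ⟩ : ∃ ρ : ℝ, ρ = 1 - 1 / (2 * L) := ⟨_, rfl⟩
  have hhalf : 1 / (2 * (L : ℝ)) ≤ 1 / 2 := by
    rw [div_le_div_iff₀ (by positivity) two_pos]
    linarith
  have hpos : 0 < 1 / (2 * (L : ℝ)) := by positivity
  have hρ0 : 0 < ρ := by linarith
  have hρ1 : ρ < 1 := by linarith
  have hnorm : ‖ρ‖ < 1 := by rwa [Real.norm_of_nonneg hρ0.le]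
  have hS : Summable fun i : ℕ => ((L : ℝ) + i) ^ 2 * ρ ^ i := by
    have h0 := (summable_pow_mul_geometric_of_norm_lt_one 0 hnorm).mul_left ((L : ℝ) ^ 2)
    have h1 := (summable_pow_mul_geometric_of_norm_lt_one 1 hnorm).mul_left (2 * (L : ℝ))
    have h2 := summable_pow_mul_geometric_of_norm_lt_one 2 hnorm
    refine ((h0.add h1).add h2).congr fun i => ?_
    ring
  refine ⟨(L : ℝ) ^ 2 + ∑' i : ℕ, ((L : ℝ) + i) ^ 2 * ρ ^ i, fun p hp hsum hc0 N => ?_⟩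
  obtain ⟨j, hjL, hj, hstep⟩ := exists_le_mul_of_sum_le_one hsum hc hc0 hL
  rw [← hρ] at hstep
  have hgeom : ∀ i, p (L + i) ≤ ρ ^ i := by
    intro i
    induction i with
    | zero =>
      have h1 := hsum (L + 1)
      rw [sum_range_succ] at h1
      have := sum_nonneg fun i (_ : i ∈ range L) => hp.nonneg i
      simpa using (by linarith : p L ≤ 1)
    | succ i ih =>
      have h1 := hp.mul_le_mul (show j ≤ L + i by omega)
      have h2 := mul_le_mul_of_nonneg_right hstep (hp.nonneg (L + i))
      have h3 : p (L + i + 1) ≤ ρ * p (L + i) := by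
        refine le_of_mul_le_mul_left ?_ hj
        linarith
      rw [pow_succ']
      exact h3.trans (mul_le_mul_of_nonneg_left ih hρ0.le)
  have hmono : ∑ i ∈ range N, (i : ℝ) ^ 2 * p i ≤ ∑ i ∈ range (L + N), (i : ℝ) ^ 2 * p i :=
    sum_le_sum_of_subset_of_nonneg (range_subset_range.2 (by omega)) fun i _ _ =>
      mul_nonneg (sq_nonneg _) (hp.nonneg i)
  rw [sum_range_add] at hmono
  have hhead : ∑ i ∈ range L, (i : ℝ) ^ 2 * p i ≤ (L : ℝ) ^ 2 := by
    calc _ ≤ ∑ i ∈ range L, (L : ℝ) ^ 2 * p i := by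
          refine sum_le_sum fun i hi => mul_le_mul_of_nonneg_right ?_ (hp.nonneg i)
          have : (i : ℝ) ≤ L := Nat.cast_le.2 (mem_range.1 hi).le
          gcongr
      _ = (L : ℝ) ^ 2 * ∑ i ∈ range L, p i := (mul_sum _ _ _).symm
      _ ≤ (L : ℝ) ^ 2 := mul_le_of_le_one_right (sq_nonneg _) (hsum L)
  have htail : ∑ i ∈ range N, ((L + i : ℕ) : ℝ) ^ 2 * p (L + i) ≤
      ∑' i : ℕ, ((L : ℝ) + i) ^ 2 * ρ ^ i := by
    refine le_trans (sum_le_sum fun i _ => ?_) (hS.sum_le_tsum (range N) fun i _ => by positivity)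
    rw [Nat.cast_add]
    exact mul_le_mul_of_nonneg_left (hgeom i) (sq_nonneg _)
  linarith

/-- The second moment of a log-concave sequence of total mass at most one about a point `k` is
bounded in terms of its value at `k`. -/
lemma exists_sum_sub_sq_mul_le {c : ℝ} (hc : 0 < c) :
    ∃ C : ℝ, ∀ p : ℕ → ℝ, LogConcaveSeq p → (∀ N, ∑ i ∈ range N, p i ≤ 1) → ∀ k, c ≤ p k →
      ∀ N, ∑ i ∈ range N, ((i : ℝ) - k) ^ 2 * p i ≤ C := by
  obtain ⟨C, hC⟩ := exists_sum_sq_mul_le hc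
  refine ⟨C + C, fun p hp hsum k hk N => ?_⟩
  have h1 := hC _ (hp.shift k) (fun N => ?_) hk N
  · have h2 := hC _ (hp.reflect k) (fun N => ?_) (by simpa using hk) (k + 1)
    · have hmono : ∑ i ∈ range N, ((i : ℝ) - k) ^ 2 * p i ≤
          ∑ i ∈ range (k + N), ((i : ℝ) - k) ^ 2 * p i :=
        sum_le_sum_of_subset_of_nonneg (range_subset_range.2 (by omega)) fun i _ _ =>
          mul_nonneg (sq_nonneg _) (hp.nonneg i)
      rw [sum_range_add, ← sum_range_reflect (fun i : ℕ => ((i : ℝ) - k) ^ 2 * p i) k] at hmono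
      rw [sum_range_succ'] at h2
      refine hmono.trans (add_le_add (le_trans (le_of_eq ?_) h2) (le_trans (le_of_eq ?_) h1))
      · rw [Nat.cast_zero, zero_pow two_ne_zero, zero_mul, add_zero]
        refine sum_congr rfl fun i hi => ?_
        have hi := mem_range.1 hi
        rw [if_pos (show i + 1 ≤ k by omega), show k - 1 - i = k - (i + 1) by omega,
          Nat.cast_sub (show i + 1 ≤ k by omega)]
        ring
      · refine sum_congr rfl fun i _ => ?_
        rw [Nat.cast_add]
        ring
    · have h3 : ∑ i ∈ range N, (if i ≤ k then p (k - i) else 0) ≤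
          ∑ i ∈ range (k + 1 + N), (if i ≤ k then p (k - i) else 0) :=
        sum_le_sum_of_subset_of_nonneg (range_subset_range.2 (by omega)) fun i _ _ =>
          (hp.reflect k).nonneg i
      have h0 : ∑ i ∈ range N, (if k + 1 + i ≤ k then p (k - (k + 1 + i)) else 0) = 0 :=
        sum_eq_zero fun i _ => if_neg (by omega)
      rw [sum_range_add, h0, add_zero,
        sum_congr rfl fun i hi => if_pos (Nat.lt_succ_iff.1 (mem_range.1 hi))] at h3
      have h4 := sum_range_reflect p (k + 1)
      rw [Nat.add_sub_cancel] at h4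
      exact h3.trans (h4.trans_le (hsum _))
  · have h3 := hsum (k + N)
    rw [sum_range_add] at h3
    linarith [sum_nonneg fun i (_ : i ∈ range k) => hp.nonneg i]

end LogConcaveTail

section RankDistribution
open scoped Classical

variable {β : Type*} [PartialOrder β] [Fintype β]

/-- The probability that exactly `j` elements precede `x` in a uniform linear extension. -/
noncomputable def rankProb (x : β) (j : ℕ) : ℝ :=
  #{l ∈ linLists univ | l.idxOf x = j} / numExt (univ : Finset β)

lemma rankProb_nonneg (x : β) (j : ℕ) : 0 ≤ rankProb x j :=
  div_nonneg (Nat.cast_nonneg _) (numExt_pos _).le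

lemma rankProb_eq_posCount (x : β) {j : ℕ} {c : Bool → ℕ} (hj : c true = j)
    (hc : #(univ : Finset β) = c true + c false + 1) :
    rankProb x j = posCount x univ c / numExt (univ : Finset β) := by
  subst hj
  rw [rankProb, posCount]
  congr 2
  refine congrArg card (filter_congr fun l hl => ?_)
  have hlen := length_of_mem_linLists hl
  have hx := mem_of_mem_linLists_univ hl x
  rw [and_iff_right (hlen.trans hc)]
  constructor
  · intro h
    rw [← h, List.getElem?_eq_getElem (List.idxOf_lt_length_iff.2 hx), List.getElem_idxOf]
  · intro h
    obtain ⟨hlt, h⟩ := List.getElem?_eq_some_iff.1 h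
    rw [← h]
    exact (mem_linLists.1 hl).1.idxOf_getElem _ _

lemma rankProb_eq_zero (x : β) {j : ℕ} (hj : #(univ : Finset β) ≤ j) : rankProb x j = 0 := by
  rw [rankProb, filter_false_of_mem, card_empty, Nat.cast_zero, zero_div]
  intro l hl h
  have := List.idxOf_lt_length_iff.2 (mem_of_mem_linLists_univ hl x)
  rw [length_of_mem_linLists hl] at this
  omega

lemma rankProb_pos_iff (x : β) {j : ℕ} (hj : j < #(univ : Finset β)) :
    0 < rankProb x j ↔
      sideCount x true univ ≤ j ∧ sideCount x false univ + j + 1 ≤ #(univ : Finset β) := by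
  obtain ⟨c, hct, hcf⟩ : ∃ c : Bool → ℕ, c true = j ∧ c false = #(univ : Finset β) - 1 - j :=
    ⟨fun σ => if σ then j else _, rfl, rfl⟩
  have hc : #(univ : Finset β) = c true + c false + 1 := by omega
  rw [rankProb_eq_posCount x hct hc, div_pos_iff_of_pos_right (numExt_pos _),
    posCount_pos_iff (mem_univ x) hc, Bool.forall_bool, hct, hcf]
  omega

lemma logConcaveSeq_rankProb (x : β) : LogConcaveSeq (rankProb x) := by
  refine ⟨rankProb_nonneg x, fun i => ?_, fun i j k hij hjk hi hk => ?_⟩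
  · by_cases hi : i + 2 < #(univ : Finset β)
    · obtain ⟨m, hm⟩ := Nat.exists_eq_add_of_lt hi
      obtain ⟨c, hct, hcf⟩ : ∃ c : Bool → ℕ, c true = i ∧ c false = m :=
        ⟨fun σ => if σ then i else m, rfl, rfl⟩
      have h := posCount_mul_le_sq (c := c) (mem_univ x) (by omega)
      have h0 : rankProb x i = _ := rankProb_eq_posCount x
        (c := c + Pi.single false 1 + Pi.single false 1) (by simpa) (by simp [-card_univ]; omega)
      have h1 : rankProb x (i + 1) = _ := rankProb_eq_posCount x
        (c := c + Pi.single false 1 + Pi.single true 1) (by simpa) (by simp [-card_univ]; omega)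
      have h2 : rankProb x (i + 2) = _ := rankProb_eq_posCount x
        (c := c + Pi.single true 1 + Pi.single true 1) (by simp [-card_univ]; omega)
        (by simp [-card_univ]; omega)
      rw [h0, h1, h2, div_pow, div_mul_div_comm, ← sq, mul_comm]
      exact div_le_div_of_nonneg_right h (sq_nonneg _)
    · rw [rankProb_eq_zero x (not_lt.1 hi), mul_zero]
      positivity
  · have hlt : k < #(univ : Finset β) := by
      by_contra! h
      exact hk.ne' (rankProb_eq_zero x h)
    rw [rankProb_pos_iff x (by omega)] at hi hk ⊢
    omega

lemma sum_mul_rankProb (x : β) (g : ℕ → ℝ) :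
    ∑ j ∈ range (Fintype.card β), g j * rankProb x j =
      (∑ f : LinExt β, g (f.1 x)) / Nat.card (LinExt β) := by
  rw [← sum_fiberwise_of_maps_to (s := univ) (t := range (Fintype.card β))
    (g := fun f : LinExt β => ((f.1 x : Fin _) : ℕ)) (fun f _ => mem_range.2 (f.1 x).2), sum_div]
  refine sum_congr rfl fun j _ => ?_
  have h := card_linExt (fun f : LinExt β => ((f.1 x : Fin _) : ℕ) = j) (fun l => l.idxOf x = j)
    fun f => by rw [f.idxOf_toList]
  rw [Nat.card_eq_fintype_card, Fintype.card_subtype] at h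
  have h' : rankProb x j =
      #{f : LinExt β | ((f.1 x : Fin _) : ℕ) = j} / numExt (univ : Finset β) := by
    rw [rankProb]
    congr 2
    convert h.symm
  rw [h', card_linExt_univ, mul_div_assoc', sum_congr rfl fun f hf => by
    rw [(mem_filter.1 hf).2], sum_const, nsmul_eq_mul, mul_comm]

lemma sum_rankProb_le_one (x : β) (N : ℕ) : ∑ j ∈ range N, rankProb x j ≤ 1 := by
  have h := sum_mul_rankProb x fun _ => 1
  simp only [one_mul, sum_const, nsmul_eq_mul, mul_one, card_univ, ← Nat.card_eq_fintype_card] at h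
  rw [card_linExt_univ, div_self (numExt_pos _).ne'] at h
  rw [← h]
  have h0 : ∑ j ∈ range (Nat.card β + N), rankProb x j =
      ∑ j ∈ range (Nat.card β), rankProb x j := by
    rw [sum_range_add, add_eq_left]
    exact sum_eq_zero fun i _ => rankProb_eq_zero x (by
      rw [card_univ, ← Nat.card_eq_fintype_card]
      omega)
  rw [← h0]
  exact sum_le_sum_of_subset_of_nonneg (range_subset_range.2 (by omega)) fun i _ _ =>
    rankProb_nonneg x i

lemma variance_le (x : β) (k : ℕ) :
    variance x ≤ ∑ j ∈ range (Fintype.card β), ((j : ℝ) - k) ^ 2 * rankProb x j := by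
  have hN : (0 : ℝ) < Nat.card (LinExt β) := by
    rw [card_linExt_univ]
    exact numExt_pos _
  rw [sum_mul_rankProb x fun j => ((j : ℝ) - k) ^ 2, variance]
  refine div_le_div_of_nonneg_right ?_ hN.le
  have hE : ∑ f : LinExt β, (_root_.val f x : ℝ) = expec x * Nat.card (LinExt β) := by
    rw [expec, div_mul_cancel₀ _ hN.ne']
  have hsplit : ∀ f : LinExt β, (((f.1 x : Fin _) : ℕ) - (k : ℝ)) ^ 2 =
      ((_root_.val f x : ℝ) - expec x) ^ 2 + 2 * (expec x - (k + 1)) * _root_.val f x +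
        ((k + 1) ^ 2 - expec x ^ 2) := by
    intro f
    rw [_root_.val, Nat.cast_add, Nat.cast_one]
    ring
  rw [sum_congr rfl fun f _ => hsplit f, sum_add_distrib, sum_add_distrib, ← mul_sum, hE, sum_const,
    card_univ, nsmul_eq_mul, ← Nat.card_eq_fintype_card]
  nlinarith [mul_nonneg hN.le (sq_nonneg (expec x - (k + 1)))]

end RankDistribution

section Concentration
open scoped Classical

variable {β : Type*} [PartialOrder β]

lemma isAntichain_ends (σ : Bool) (X : Finset β) :
    IsAntichain (· ≤ ·) (ends σ X : Set β) := by
  intro a ha b hb hab hle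
  have hlt := lt_of_le_of_ne hle hab
  cases σ
  · exact (mem_ends.1 ha).2 b (mem_ends.1 hb).1 hlt
  · exact (mem_ends.1 hb).2 a (mem_ends.1 ha).1 hlt

lemma exists_mem_ends_le (X : Finset β) {a : β} (ha : a ∈ X) : ∃ b ∈ ends true X, b ≤ a := by
  obtain ⟨b, hba, hb⟩ := X.exists_le_minimal ha
  exact ⟨b, mem_ends.2 ⟨hb.1, fun y hy h => hb.not_lt hy h⟩, hba⟩

lemma exists_mem_ends_ge (X : Finset β) {a : β} (ha : a ∈ X) : ∃ b ∈ ends false X, a ≤ b := by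
  obtain ⟨b, hba, hb⟩ := X.exists_le_maximal ha
  exact ⟨b, mem_ends.2 ⟨hb.1, fun y hy h => hb.not_gt hy h⟩, hba⟩

variable [Fintype β]

/-- If no element is nearly balanced against `x`, then with probability bounded below in terms of
the width, exactly the elements likely to precede `x` do so; in particular some rank of `x` is
attained with at least this probability. -/
lemma exists_le_rankProb {w : ℕ}
    (hw : ∀ A : Finset β, IsAntichain (· ≤ ·) (A : Set β) → #A ≤ w) {η : ℝ} (hη0 : 0 ≤ η)
    (hη : η ≤ 1 / 2) {x : β} (hx : ∀ y ≠ x, min (prLT x y) (prLT y x) ≤ 1 / 2 - η) :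
    ∃ k, ((2 * η) ^ w / 2) ^ w * (2 * η) ^ w ≤ rankProb x k := by
  let D : Finset β := {y | y ≠ x ∧ 1 / 2 + η ≤ prLT y x}
  let U : Finset β := {y | y ≠ x ∧ y ∉ D}
  have hU : ∀ u ∈ U, u ≠ x ∧ 1 / 2 + η ≤ prLT x u := by
    intro u hu
    simp only [U, D, mem_filter_univ, not_and, not_le] at hu
    refine ⟨hu.1, ?_⟩
    have h1 := hu.2 hu.1
    have h2 := prLT_add_prLT hu.1
    rcases min_le_iff.1 (hx u hu.1) with h | h <;> linarith
  have hD : ∀ d ∈ D, d ≠ x ∧ 1 / 2 + η ≤ prLT d x := fun d hd => (mem_filter.1 hd).2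
  have hN := numExt_pos (univ : Finset β)
  have key := le_sum_of_subset_of_disjoint (belowWeight_nonneg x) (belowWeight_logSupermodular x)
    hη0 hη (hw _ (isAntichain_ends false D)) (hw _ (isAntichain_ends true U))
    (fun d hd => by
      rw [sum_belowWeight_univ, sum_mem_belowWeight]
      exact mul_le_mul_of_nonneg_right (hD d (mem_ends.1 hd).1).2 hN.le)
    (fun u hu => by
      have := hU u (mem_ends.1 hu).1
      rw [sum_belowWeight_univ, sum_notMem_belowWeight this.1]
      exact mul_le_mul_of_nonneg_right this.2 hN.le)
  rw [sum_belowWeight_univ, sum_belowWeight] at key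
  refine ⟨#D, ?_⟩
  rw [rankProb, le_div_iff₀ hN]
  refine key.trans (Nat.cast_le.2 (card_le_card fun l hl => ?_))
  obtain ⟨hl, hDl, hUl⟩ := mem_filter.1 hl
  have hI := isBelow_below (x := x) hl
  have hbelow : below x l = D := by
    ext y
    constructor
    · intro hy
      by_contra hyD
      have hyU : y ∈ U := mem_filter.2 ⟨mem_univ _, fun h => hI.2.2 (h ▸ hy), hyD⟩
      obtain ⟨u, hu, huy⟩ := exists_mem_ends_le U hyU
      refine hUl u hu ?_
      rcases huy.eq_or_lt with rfl | h
      exacts [hy, hI.1 y hy u h]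
    · intro hy
      obtain ⟨d, hd, hyd⟩ := exists_mem_ends_ge D hy
      rcases hyd.eq_or_lt with rfl | h
      exacts [hDl hd, hI.1 d (hDl hd) y h]
  refine mem_filter.2 ⟨hl, ?_⟩
  rw [← hbelow]
  obtain ⟨f, rfl⟩ := LinExt.exists_toList_eq hl
  have : below x f.toList = (Iio (f.1 x)).map f.1.symm.toEmbedding := by
    ext y
    simp [mem_below, f.idxOf_toList]
  rw [this, card_map, Fin.card_Iio, f.idxOf_toList]

end Concentration

/-- If no element is nearly balanced against `x`, then the standard deviation of the rank of `x` is
bounded in terms of the width. -/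
theorem exists_sigma_lt_of_unbalanced (w : ℕ) {ε : ℝ} (hε : 0 < ε) :
    ∃ S : ℝ, ∀ (β : Type) [Fintype β] [PartialOrder β],
      (∀ A : Finset β, IsAntichain (· ≤ ·) (A : Set β) → A.card ≤ w) →
      ∀ x : β, (∀ y ≠ x, min (prLT x y) (prLT y x) ≤ 1 / 2 - ε) → sigma x < S := by
  have hη : 0 < min ε (1 / 2) := lt_min hε one_half_pos
  have hc : 0 < ((2 * min ε (1 / 2)) ^ w / 2) ^ w * (2 * min ε (1 / 2)) ^ w := by positivity
  obtain ⟨C, hC⟩ := exists_sum_sub_sq_mul_le hc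
  refine ⟨√C + 1, fun β _ _ hw x hx => ?_⟩
  obtain ⟨k, hk⟩ := exists_le_rankProb hw hη.le (min_le_right _ _) (x := x) fun y hy =>
    (hx y hy).trans (sub_le_sub_left (min_le_left _ _) _)
  have h := (variance_le x k).trans (hC _ (logConcaveSeq_rankProb x) (sum_rankProb_le_one x) k hk _)
  exact (Real.sqrt_le_sqrt h).trans_lt (lt_add_one _)

/-- for fixed width bound `w` and `ε > 0` there is `S` such that for every
finite poset of width at most `w` and every `x` with `σ(x) ≥ S` one has `δ_x > 1/2 - ε`;
in particular `δ(P) > 1/2 - ε` whenever `w(P) ≤ w` and `σ(P) ≥ S`. -/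
theorem stmt_1 (w : ℕ) (hw : 1 ≤ w) (ε : ℝ) (hε : 0 < ε) :
    ∃ S : ℝ,
      (∀ (β : Type) [Fintype β] [PartialOrder β],
        (∀ A : Finset β, IsAntichain (· ≤ ·) (A : Set β) → A.card ≤ w) →
        ∀ x : β, S ≤ sigma x →
          ∃ y : β, y ≠ x ∧ 1 / 2 - ε < min (prLT x y) (prLT y x)) ∧
      (∀ (β : Type) [Fintype β] [PartialOrder β],
        (∀ A : Finset β, IsAntichain (· ≤ ·) (A : Set β) → A.card ≤ w) →
        (∃ x : β, S ≤ sigma x) →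
          ∃ x y : β, x ≠ y ∧ 1 / 2 - ε < min (prLT x y) (prLT y x)) := by
  obtain ⟨S, hS⟩ := exists_sigma_lt_of_unbalanced w hε
  have hmain : ∀ (β : Type) [Fintype β] [PartialOrder β],
      (∀ A : Finset β, IsAntichain (· ≤ ·) (A : Set β) → A.card ≤ w) →
      ∀ x : β, S ≤ sigma x → ∃ y : β, y ≠ x ∧ 1 / 2 - ε < min (prLT x y) (prLT y x) := by
    intro β _ _ hβ x hx
    by_contra! hcon
    exact (hS β hβ x hcon).not_ge hx
  refine ⟨S, hmain, fun β _ _ hβ ⟨x, hx⟩ => ?_⟩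
  obtain ⟨y, hyx, hy⟩ := hmain β hβ x hx
  exact ⟨x, y, hyx.symm, hy⟩
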